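/- Let C be a closed convex subset of X and let γ be a simple closed curve contained in E. Define dist_C : X → ℝ by dist_C(x) = d(x, C). Let p be a point of γ at which dist_C attains its maximum over γ but such that dist_C restricted to γ is not locally constant at p. Then γ is not locally geodesic in Y at the point p, i.e., no subarc of γ containing p in its relative interior is a geodesic in Y. -/

import Mathlib

open Set Metric Filter

noncomputable section

namespace Cat2Cx

/-! ### Comparison angles -/

/-- Inverse hyperbolic cosine. -/
def arcosh (x : ℝ) : ℝ := Real.log (x + Real.sqrt (x ^ 2 - 1))

/-- The Euclidean comparison angle at the vertex of a (comparison) triangle whose adjacent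
sides have lengths `a`, `b` and whose opposite side has length `c`, via the law of cosines. -/
def euclCompAngle (a b c : ℝ) : ℝ :=
  Real.arccos ((a ^ 2 + b ^ 2 - c ^ 2) / (2 * a * b))

/-- The comparison angle in the model plane `M_κ²` of constant curvature `κ ≤ 0`, via the
(Euclidean or hyperbolic) law of cosines. -/
def compAngle (κ a b c : ℝ) : ℝ :=
  if κ = 0 then euclCompAngle a b c
  else
    Real.arccos
      ((Real.cosh (Real.sqrt (-κ) * a) * Real.cosh (Real.sqrt (-κ) * b) -
          Real.cosh (Real.sqrt (-κ) * c)) /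
        (Real.sinh (Real.sqrt (-κ) * a) * Real.sinh (Real.sqrt (-κ) * b)))

variable {Z : Type*}

/-! ### Geodesics with respect to a distance function -/

/-- `f` restricted to `[a,b]` is a unit-speed geodesic for the distance function `d`
(an isometric embedding of the compact interval `[a,b]`). -/
def IsGeodesicWrt (d : Z → Z → ℝ) (f : ℝ → Z) (a b : ℝ) : Prop :=
  a ≤ b ∧ ∀ s ∈ Icc a b, ∀ t ∈ Icc a b, d (f s) (f t) = |s - t|

/-- `f` is a unit-speed geodesic from `x` to `y` (for the distance function `d`),
staying inside `S`. -/
def IsGeodesicFromTo (d : Z → Z → ℝ) (S : Set Z) (f : ℝ → Z) (x y : Z) : Prop :=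
  f 0 = x ∧ f (d x y) = y ∧ IsGeodesicWrt d f 0 (d x y) ∧ MapsTo f (Icc 0 (d x y)) S

/-- `S`, with the distance function `d`, is a geodesic space. -/
def GeodesicSpaceWrt (d : Z → Z → ℝ) (S : Set Z) : Prop :=
  ∀ x ∈ S, ∀ y ∈ S, ∃ f, IsGeodesicFromTo d S f x y

/-- The geodesic segment `[x,y]`: the union of (the images of) all geodesics from `x` to `y`
inside `S`.  In a uniquely geodesic space this is the image of the unique geodesic. -/
def geodSeg (d : Z → Z → ℝ) (S : Set Z) (x y : Z) : Set Z :=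
  ⋃ f ∈ {f : ℝ → Z | IsGeodesicFromTo d S f x y}, f '' Icc 0 (d x y)

/-- `C ⊆ S` is geodesically convex with respect to `d`: every geodesic (in `S`) between two
points of `C` lies in `C`. -/
def ConvexWrtIn (d : Z → Z → ℝ) (S C : Set Z) : Prop :=
  ∀ x ∈ C, ∀ y ∈ C, geodSeg d S x y ⊆ C

/-- `C` is geodesically convex with respect to `d`. -/
abbrev ConvexWrt (d : Z → Z → ℝ) (C : Set Z) : Prop := ConvexWrtIn d univ C

/-- The geodesically convex hull of `A` with respect to `d`. -/
def convexHullWrt (d : Z → Z → ℝ) (A : Set Z) : Set Z :=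
  ⋂₀ {C | ConvexWrt d C ∧ A ⊆ C}

/-- The Alexandrov (upper) angle at `p` between two paths `σ`, `τ` issuing from `p`
(each parametrized so that `σ 0 = τ 0 = p`): the limit as `ε → 0⁺` (i.e. the infimum over
`ε > 0`) of the supremum over `0 < s, t < ε` of the Euclidean comparison angles. -/
def upperAngleWrt (d : Z → Z → ℝ) (p : Z) (σ τ : ℝ → Z) : ℝ :=
  sInf {a | ∃ ε > 0, a = sSup {b | ∃ s t : ℝ, 0 < s ∧ s < ε ∧ 0 < t ∧ t < ε ∧
      b = euclCompAngle (d p (σ s)) (d p (τ t)) (d (σ s) (τ t))}}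

/-- The CAT(κ) condition (for `κ ≤ 0`), in the angle-comparison form
(Bridson–Haefliger II.1.7(4)): `S` is geodesic and for every triple of distinct points the
Alexandrov angle between geodesics is at most the comparison angle in `M_κ²`. -/
def IsCATWrt (κ : ℝ) (d : Z → Z → ℝ) (S : Set Z) : Prop :=
  GeodesicSpaceWrt d S ∧
    ∀ p ∈ S, ∀ q ∈ S, ∀ r ∈ S, p ≠ q → p ≠ r → q ≠ r →
      ∀ σ τ : ℝ → Z, IsGeodesicFromTo d S σ p q → IsGeodesicFromTo d S τ p r →
        upperAngleWrt d p σ τ ≤ compAngle κ (d p q) (d p r) (d q r)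

/-- Completeness of `S` with respect to the distance function `d`:
every Cauchy sequence converges. -/
def CompleteWrt (d : Z → Z → ℝ) (S : Set Z) : Prop :=
  ∀ u : ℕ → Z, (∀ n, u n ∈ S) →
    (∀ ε > 0, ∃ N, ∀ m ≥ N, ∀ n ≥ N, d (u m) (u n) < ε) →
    ∃ x ∈ S, ∀ ε > 0, ∃ N, ∀ n ≥ N, d (u n) x < ε

variable {X : Type*} [MetricSpace X]

/-- `X` is a CAT(κ) metric space. -/
def IsCATSpace (κ : ℝ) (X : Type*) [MetricSpace X] : Prop :=
  IsCATWrt κ (fun x y : X => dist x y) univ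

/-- The distance function of the metric space `X`. -/
abbrev xDist (X : Type*) [MetricSpace X] : X → X → ℝ := fun x y => dist x y

/-! ### The model plane `M_κ²` and polyhedral 2-complexes -/

/-- The distance function of the model plane `M_κ²` of constant curvature `κ ≤ 0`, in global
coordinates `ℝ²`: the Euclidean distance for `κ = 0`, and for `κ < 0` the distance of the
hyperboloid model rescaled by `1/√(-κ)` (so that the curvature is `κ`). -/
def mDist (κ : ℝ) (u v : ℝ × ℝ) : ℝ :=
  if κ = 0 then Real.sqrt ((u.1 - v.1) ^ 2 + (u.2 - v.2) ^ 2)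
  else
    (1 / Real.sqrt (-κ)) *
      arcosh (Real.sqrt (1 + u.1 ^ 2 + u.2 ^ 2) * Real.sqrt (1 + v.1 ^ 2 + v.2 ^ 2) -
        u.1 * v.1 - u.2 * v.2)

/-- A convex polygonal 2-cell in `M_κ²`: the geodesically convex hull of a finite set of
points, with nonempty interior. -/
def IsPolygonalCell (κ : ℝ) (P : Set (ℝ × ℝ)) : Prop :=
  ∃ F : Finset (ℝ × ℝ), P = convexHullWrt (mDist κ) (F : Set (ℝ × ℝ)) ∧ (interior P).Nonempty

/-- The subset `S` of `X` embeds isometrically into the model plane `M_κ²`. -/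
def IsomEmbedsInModelPlane (κ : ℝ) (S : Set X) : Prop :=
  ∃ f : X → ℝ × ℝ, ∀ x ∈ S, ∀ y ∈ S, mDist κ (f x) (f y) = dist x y

/-- A locally finite `M_κ`-polyhedral 2-complex structure on the metric space `X`:
`X` is partitioned into open 2-cells (faces), open 1-cells (edges) and vertices; the closure of
each face is isometric to a compact convex polygon of the model plane `M_κ²` (so each face has
constant curvature `κ`), each edge is a geodesic arc, and the complex is locally finite. -/
structure PolyComplex2 (κ : ℝ) (X : Type*) [MetricSpace X] where
  faces : Set (Set X)
  edges : Set (Set X)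
  vertices : Set X
  faces_open : ∀ F ∈ faces, IsOpen F
  cover : ⋃₀ faces ∪ ⋃₀ edges ∪ vertices = univ
  cells_disjoint : ∀ c ∈ faces ∪ edges, ∀ c' ∈ faces ∪ edges, c ≠ c' → c ∩ c' = ∅
  cells_vertex_disjoint : ∀ c ∈ faces ∪ edges, c ∩ vertices = ∅
  face_chart : ∀ F ∈ faces, ∃ (f : X → ℝ × ℝ) (P : Set (ℝ × ℝ)),
    IsPolygonalCell κ P ∧ InjOn f (closure F) ∧ f '' closure F = P ∧ f '' F = interior P ∧
    ∀ x ∈ closure F, ∀ y ∈ closure F, mDist κ (f x) (f y) = dist x y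
  edge_geodesic : ∀ e ∈ edges, ∃ (f : ℝ → X) (L : ℝ), 0 < L ∧
    IsGeodesicWrt (fun x y : X => dist x y) f 0 L ∧ f '' Ioo 0 L = e
  edge_closure : ∀ e ∈ edges, closure e \ e ⊆ vertices
  face_closure : ∀ F ∈ faces, closure F \ F ⊆ ⋃₀ edges ∪ vertices
  locally_finite : ∀ x : X, ∃ ε > 0,
    {c | (c ∈ faces ∨ c ∈ edges) ∧ (c ∩ ball x ε).Nonempty}.Finite ∧
    (vertices ∩ ball x ε).Finite

/-! ### Simple closed curves, their interiors, and first homology -/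

/-- A simple closed curve in `X` (identified with its image). -/
structure SCC (X : Type*) [TopologicalSpace X] where
  toFun : ℝ → X
  contOn : ContinuousOn toFun (Icc 0 1)
  loop : toFun 0 = toFun 1
  inj : InjOn toFun (Ico 0 1)

/-- The image of a simple closed curve. -/
def SCC.img {X : Type*} [TopologicalSpace X] (γ : SCC X) : Set X := γ.toFun '' Icc 0 1

/-- The first singular homology class of a loop, via the Hurewicz isomorphism: the class of
the loop in the abelianization of the fundamental group (of its path component); the loop is
nullhomologous iff this class is trivial. -/
def loopClassH1 {B : Type*} [TopologicalSpace B] {x : B} (p : Path x x) :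
    Abelianization (FundamentalGroup B x) :=
  Abelianization.of (FundamentalGroup.fromPath (X := TopCat.of B) ⟦p⟧)

/-- The basepoint of a simple closed curve, regarded in a subspace `B` containing it. -/
def SCC.basePoint {X : Type*} [TopologicalSpace X] (γ : SCC X) (B : Set X)
    (h : γ.img ⊆ B) : B :=
  ⟨γ.toFun 0, h ⟨0, ⟨le_rfl, zero_le_one⟩, rfl⟩⟩

/-- The loop of a simple closed curve, as a `Path` in a subspace `B` containing it. -/
def SCC.pathIn {X : Type*} [TopologicalSpace X] (γ : SCC X) (B : Set X) (h : γ.img ⊆ B) :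
    Path (γ.basePoint B h) (γ.basePoint B h) where
  toFun t := ⟨γ.toFun t, h ⟨(t : ℝ), t.2, rfl⟩⟩
  continuous_toFun := by
    apply Continuous.subtype_mk
    exact γ.contOn.comp_continuous continuous_subtype_val fun t => t.2
  source' := by
    apply Subtype.ext
    rfl
  target' := by
    apply Subtype.ext
    exact γ.loop.symm

/-- The simple closed curve `γ` is nullhomologous in the subspace `B` of `X`:
its class in `H₁(B)` vanishes. -/
def SCC.NullhomologousIn {X : Type*} [TopologicalSpace X] (γ : SCC X) (B : Set X) : Prop :=
  ∀ h : γ.img ⊆ B, loopClassH1 (γ.pathIn B h) = 1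

/-- The interior of a simple closed curve `γ`:
`Int γ = {x ∈ X \ γ | [γ] ≠ 0 ∈ H₁(X \ {x})}`. -/
def SCC.interiorSet {X : Type*} [TopologicalSpace X] (γ : SCC X) : Set X :=
  {x | x ∉ γ.img ∧ ¬ γ.NullhomologousIn {x}ᶜ}

/-- The first singular homology of `B` vanishes: every loop in `B` is nullhomologous
(via the Hurewicz isomorphism on each path component). -/
def H1Trivial (B : Type*) [TopologicalSpace B] : Prop :=
  ∀ (x : B) (p : Path x x), loopClassH1 p = 1

/-! ### Rectifiable connectedness and the induced path metric -/

/-- `g` is a path from `x` to `y` (parametrized by `[0,1]`) inside `E`. -/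
def IsPathIn {X : Type*} [TopologicalSpace X] (E : Set X) (g : ℝ → X) (x y : X) : Prop :=
  ContinuousOn g (Icc 0 1) ∧ g 0 = x ∧ g 1 = y ∧ MapsTo g (Icc 0 1) E

/-- `E` is rectifiably connected: any two of its points are joined by a rectifiable
(finite length) path in `E`. -/
def RectConnected {X : Type*} [MetricSpace X] (E : Set X) : Prop :=
  ∀ x ∈ E, ∀ y ∈ E, ∃ g : ℝ → X, IsPathIn E g x y ∧ eVariationOn g (Icc 0 1) ≠ ⊤

/-- The induced path metric on `E`: the infimum of the lengths of rectifiable paths in `E`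
joining the two points. -/
def pathDistIn {X : Type*} [MetricSpace X] (E : Set X) (x y : X) : ℝ :=
  (⨅ g : {g : ℝ → X // IsPathIn E g x y}, eVariationOn g.1 (Icc 0 1)).toReal


universe u
/-! ### Conical neighborhoods -/


/-- The distance function of the `κ`-cone (κ ≤ 0) over a space with distance function `dL`:
a point is a pair (radius, link point), all points of radius `0` being identified (the cone
point); the distance is given by the law of cosines in curvature `κ`, with angle
`min π (dL ℓ ℓ')`. -/
def coneDist (κ : ℝ) {L : Type*} (dL : L → L → ℝ) (a b : ℝ × L) : ℝ :=
  if κ = 0 then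
    Real.sqrt (a.1 ^ 2 + b.1 ^ 2 - 2 * a.1 * b.1 * Real.cos (min Real.pi (dL a.2 b.2)))
  else
    (1 / Real.sqrt (-κ)) *
      arcosh (Real.cosh (Real.sqrt (-κ) * a.1) * Real.cosh (Real.sqrt (-κ) * b.1) -
        Real.sinh (Real.sqrt (-κ) * a.1) * Real.sinh (Real.sqrt (-κ) * b.1) *
          Real.cos (min Real.pi (dL a.2 b.2)))

/-- `V` is a conical neighborhood of `p` in `X`: an open neighborhood of `p` isometric to a
convex open subset of the `κ`-cone over a metric space (the link of `p`), the isometry taking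
`p` to the cone point. -/
def IsConicalNbhd (κ : ℝ) (p : X) (V : Set X) : Prop :=
  IsOpen V ∧ p ∈ V ∧
    ∃ (L : Type u) (dL : L → L → ℝ) (f : X → ℝ × L),
      (∀ a, dL a a = 0) ∧ (∀ a b, 0 ≤ dL a b) ∧ (∀ a b, dL a b = dL b a) ∧
      (∀ a b c, dL a c ≤ dL a b + dL b c) ∧
      (∀ x ∈ V, 0 ≤ (f x).1) ∧ (f p).1 = 0 ∧
      (∀ x ∈ V, ∀ y ∈ V, dist x y = coneDist κ dL (f x) (f y)) ∧
      (∀ x ∈ V, (f x).1 = 0 → x = p) ∧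
      ConvexWrtIn (coneDist κ dL) {w : ℝ × L | 0 ≤ w.1} (f '' V) ∧
      (∀ z ∈ f '' V, ∃ ε > 0, ∀ w : ℝ × L, 0 ≤ w.1 → coneDist κ dL z w < ε → w ∈ f '' V)

/-! ### Geodesics, triangles, and limit segments in `Y = (E, induced path metric)` -/

/-- The set `α` is (the image of) a geodesic arc of `Y = (E, pathDistIn E)`. -/
def IsYGeodesicArc (E : Set X) (α : Set X) : Prop :=
  ∃ (f : ℝ → X) (a b : ℝ), IsGeodesicWrt (pathDistIn E) f a b ∧
    MapsTo f (Icc a b) E ∧ f '' Icc a b = α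

/-- `T` is a geodesic triangle of `Y = (E, pathDistIn E)` with vertices `p`, `q`, `r`:
the union of the three `Y`-geodesics joining the vertices. -/
def IsYTriangle (E : Set X) (T : Set X) (p q r : X) : Prop :=
  p ∈ E ∧ q ∈ E ∧ r ∈ E ∧
    T = geodSeg (pathDistIn E) E p q ∪ geodSeg (pathDistIn E) E q r ∪
        geodSeg (pathDistIn E) E r p

/-- The set `γim` (a curve in `E`) is locally geodesic in `Y` at `p`: some subarc of `γim`
containing `p` in its relative interior is a geodesic of `Y`. -/
def LocallyYGeodesicAt (E γim : Set X) (p : X) : Prop :=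
  ∃ (f : ℝ → X) (a b t : ℝ), t ∈ Ioo a b ∧ f t = p ∧
    IsGeodesicWrt (pathDistIn E) f a b ∧ MapsTo f (Icc a b) E ∧ f '' Icc a b ⊆ γim

/-- `f : [0,1] → E` is the constant-speed parametrization of the `Y`-geodesic
from `x` to `y`. -/
def IsConstSpeedYGeodesic (E : Set X) (f : ℝ → X) (x y : X) : Prop :=
  f 0 = x ∧ f 1 = y ∧ MapsTo f (Icc 0 1) E ∧
    ∀ s ∈ Icc (0:ℝ) 1, ∀ t ∈ Icc (0:ℝ) 1,
      pathDistIn E (f s) (f t) = pathDistIn E x y * |s - t|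

/-- `R` is the limit segment of length `ε` at `p` of the `Y`-geodesic side from `p` to `q`:
`R` is an `X`-geodesic of length `ε` issuing from `p`, and the `X`-geodesics of length `ε`
from `p` through `σ t` (σ the `Y`-geodesic from `p` to `q`) converge uniformly to `R`
as `t → 0⁺`. -/
def IsLimitSegment (E : Set X) (p q : X) (ε : ℝ) (R : ℝ → X) : Prop :=
  0 < ε ∧ R 0 = p ∧ IsGeodesicWrt (fun x y : X => dist x y) R 0 ε ∧
    ∀ σ : ℝ → X, IsGeodesicFromTo (pathDistIn E) E σ p q →
      ∀ δ > 0, ∃ t₀ > 0, ∀ t, 0 < t → t ≤ t₀ → t ≤ pathDistIn E p q →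
        ∀ g : ℝ → X, IsGeodesicWrt (fun x y : X => dist x y) g 0 ε → g 0 = p →
          g (dist p (σ t)) = σ t → ∀ s ∈ Icc 0 ε, dist (g s) (R s) ≤ δ


end Cat2Cx

end

namespace Cat2Cx

/-- A metric space which has points dividing any segment at prescribed distances, and in which
the Stewart (weighted Bruhat–Tits) inequality of a Euclidean triangle holds. -/
structure IsStewartSpace (X : Type*) [MetricSpace X] : Prop where
  exists_dist_eq : ∀ (x y : X) (r : ℝ), 0 ≤ r → r ≤ dist x y →
    ∃ m, dist x m = r ∧ dist m y = dist x y - r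
  stewart : ∀ x y m z : X, dist x m + dist m y = dist x y →
    dist x y * dist z m ^ 2 ≤ dist m y * dist z x ^ 2 + dist x m * dist z y ^ 2
      - dist x m * dist m y * dist x y

/-- `cosh ∘ √` is convex. -/
theorem cosh_le_of_sq_eq {c x y l : ℝ} (h0 : 0 ≤ l) (h1 : l ≤ 1)
    (hc : c ^ 2 = l * x ^ 2 + (1 - l) * y ^ 2) :
    Real.cosh c ≤ l * Real.cosh x + (1 - l) * Real.cosh y := by
  refine hasSum_le (fun n => ?_) (Real.hasSum_cosh c)
    (((Real.hasSum_cosh x).mul_left l).add ((Real.hasSum_cosh y).mul_left (1 - l)))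
  have h := (convexOn_pow (𝕜 := ℝ) n).2 (sq_nonneg x) (sq_nonneg y) h0 (sub_nonneg.2 h1)
    (by ring)
  simp only [smul_eq_mul] at h
  rw [← hc] at h
  rw [pow_mul, pow_mul, pow_mul, ← mul_div_assoc, ← mul_div_assoc, ← add_div]
  gcongr

theorem compAngle_le_euclCompAngle {κ a b c : ℝ} (hκ : κ ≤ 0) (ha : 0 < a) (hb : 0 < b)
    (h1 : c ≤ a + b) (h2 : a ≤ c + b) (h3 : b ≤ c + a) :
    compAngle κ a b c ≤ euclCompAngle a b c := by
  unfold compAngle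
  split_ifs with h
  · exact le_rfl
  have hk : 0 < Real.sqrt (-κ) := Real.sqrt_pos.2 (by
    rcases lt_or_eq_of_le hκ with h' | h'
    · linarith
    · exact absurd h' h)
  set k := Real.sqrt (-κ)
  apply Real.arccos_le_arccos
  have hs1 : 0 < Real.sinh (k * a) := Real.sinh_pos_iff.2 (by positivity)
  have hs2 : 0 < Real.sinh (k * b) := Real.sinh_pos_iff.2 (by positivity)
  rw [le_div_iff₀ (by positivity)]
  have hc0 : 0 ≤ c := by linarith
  set t := (a ^ 2 + b ^ 2 - c ^ 2) / (2 * a * b) with ht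
  have ht' : t * (2 * a * b) = a ^ 2 + b ^ 2 - c ^ 2 := by
    rw [ht]; field_simp
  have hab : 0 < 2 * a * b := by positivity
  have t1 : t ≤ 1 := by
    rw [ht, div_le_one hab]; nlinarith
  have t2 : -1 ≤ t := by
    rw [ht, le_div_iff₀ hab]; nlinarith
  have := cosh_le_of_sq_eq (c := k * c) (x := k * a + k * b) (y := k * a - k * b)
    (l := (1 - t) / 2) (by linarith) (by linarith) (by
      have : c ^ 2 = a ^ 2 + b ^ 2 - t * (2 * a * b) := by linarith
      rw [mul_pow, this]; ring)
  rw [Real.cosh_add, Real.cosh_sub] at this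
  linarith

theorem exists_euclCompAngle_lt {Z : Type*} {d : Z → Z → ℝ} {p : Z} {σ τ : ℝ → Z} {α : ℝ}
    (h : upperAngleWrt d p σ τ < α) :
    ∃ ε > 0, ∀ s t, 0 < s → s < ε → 0 < t → t < ε →
      euclCompAngle (d p (σ s)) (d p (τ t)) (d (σ s) (τ t)) < α := by
  obtain ⟨a, ⟨ε, hε, rfl⟩, ha⟩ := exists_lt_of_csInf_lt (by exact ⟨_, 1, one_pos, rfl⟩) h
  refine ⟨ε, hε, fun s t hs hs' ht ht' => lt_of_le_of_lt (le_csSup ⟨Real.pi, ?_⟩ ?_) ha⟩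
  · rintro _ ⟨s, t, -, -, -, -, rfl⟩
    exact Real.arccos_le_pi _
  · exact ⟨s, t, hs, hs', ht, ht', rfl⟩

theorem abs_cosine_le_one {a b c : ℝ} (ha : 0 < a) (hb : 0 < b)
    (h1 : c ≤ a + b) (h2 : a ≤ c + b) (h3 : b ≤ c + a) :
    -1 ≤ (a ^ 2 + b ^ 2 - c ^ 2) / (2 * a * b) ∧ (a ^ 2 + b ^ 2 - c ^ 2) / (2 * a * b) ≤ 1 := by
  have hab : 0 < 2 * a * b := by positivity
  constructor
  · rw [le_div_iff₀ hab]; nlinarith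
  · rw [div_le_one hab]; nlinarith

/-- First variation: along geodesics issuing from `m` towards `x` and `z`, the squared distance
is eventually smaller than the one prescribed by any angle larger than the comparison angle. -/
theorem IsCATSpace.exists_dist_sq_lt {κ : ℝ} (hκ : κ ≤ 0) {X : Type*} [MetricSpace X]
    (hX : IsCATSpace κ X) {m x z : X} (hmx : m ≠ x) (hmz : m ≠ z) (hxz : x ≠ z)
    {σ ω : ℝ → X} (hσ : IsGeodesicFromTo (fun x y : X => dist x y) univ σ m x)
    (hω : IsGeodesicFromTo (fun x y : X => dist x y) univ ω m z) {e : ℝ} (he : -1 ≤ e)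
    (hlt : e < (dist m x ^ 2 + dist m z ^ 2 - dist x z ^ 2) / (2 * dist m x * dist m z)) :
    ∃ ε > 0, ∀ s r, 0 < s → s < ε → 0 < r → r < ε →
      dist (σ s) (ω r) ^ 2 < s ^ 2 + r ^ 2 - 2 * s * r * e := by
  have ha : 0 < dist m x := dist_pos.2 hmx
  have hc : 0 < dist m z := dist_pos.2 hmz
  have t1 : dist x z ≤ dist m x + dist m z := dist_triangle_left _ _ _
  have t2 : dist m x ≤ dist x z + dist m z := by
    have := dist_triangle_right m x z; linarith
  have t3 : dist m z ≤ dist x z + dist m x := by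
    have := dist_triangle m x z; linarith
  have hE := abs_cosine_le_one ha hc t1 t2 t3
  have hup : upperAngleWrt (fun x y : X => dist x y) m σ ω < Real.arccos e :=
    lt_of_le_of_lt ((hX.2 m trivial x trivial z trivial hmx hmz hxz σ ω hσ hω).trans
      (compAngle_le_euclCompAngle hκ ha hc t1 t2 t3))
      (Real.arccos_lt_arccos he hlt hE.2)
  obtain ⟨ε, hε, h⟩ := exists_euclCompAngle_lt hup
  refine ⟨min ε (min (dist m x) (dist m z)), by positivity, fun s r hs hs' hr hr' => ?_⟩
  rw [lt_min_iff, lt_min_iff] at hs' hr'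
  have h' := h s r hs hs'.1 hr hr'.1
  have e1 : dist m (σ s) = s := by
    have := hσ.2.2.1.2 0 ⟨le_rfl, ha.le⟩ s ⟨hs.le, hs'.2.1.le⟩
    simpa [hσ.1, abs_of_pos hs] using this
  have e2 : dist m (ω r) = r := by
    have := hω.2.2.1.2 0 ⟨le_rfl, hc.le⟩ r ⟨hr.le, hr'.2.2.le⟩
    simpa [hω.1, abs_of_pos hr] using this
  simp only [e1, e2, euclCompAngle] at h'
  have h'' := lt_of_not_ge fun hge => absurd (Real.arccos_le_arccos hge) (not_le.2 h')
  rw [lt_div_iff₀ (by positivity)] at h''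
  linarith

theorem IsCATSpace.isStewartSpace {κ : ℝ} (hκ : κ ≤ 0) {X : Type*} [MetricSpace X]
    (hX : IsCATSpace κ X) : IsStewartSpace X := by
  constructor
  · intro x y r h0 h1
    obtain ⟨f, hf0, hf1, hf, -⟩ := hX.1 x trivial y trivial
    refine ⟨f r, ?_, ?_⟩
    · have := hf.2 0 ⟨le_rfl, dist_nonneg⟩ r ⟨h0, h1⟩
      simpa [hf0, abs_of_nonneg h0] using this
    · have := hf.2 r ⟨h0, h1⟩ (dist x y) ⟨dist_nonneg, le_rfl⟩
      simpa [hf1, abs_of_nonpos (sub_nonpos.2 h1)] using this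
  · intro x y m z hm
    rcases eq_or_ne m x with rfl | hmx
    · simp [dist_comm]
    rcases eq_or_ne m y with rfl | hmy
    · simp [dist_comm]
    have ha : 0 < dist m x := dist_pos.2 hmx
    have hb : 0 < dist m y := dist_pos.2 hmy
    rw [dist_comm x m] at *
    rcases eq_or_ne m z with rfl | hmz
    · rw [← hm, dist_self]
      exact le_of_eq (by ring)
    rcases eq_or_ne x z with rfl | hxz
    · rw [dist_self, ← hm, dist_comm x m]
      exact le_of_eq (by ring)
    rcases eq_or_ne y z with rfl | hyz
    · rw [dist_self, dist_comm y m, dist_comm y x, ← hm]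
      exact le_of_eq (by ring)
    have hc : 0 < dist m z := dist_pos.2 hmz
    set a := dist m x
    set b := dist m y
    set c := dist m z with hcdef
    have hE1 := abs_cosine_le_one (a := dist m x) (b := dist m z) (c := dist x z) ha hc
      (dist_triangle_left _ _ _)
      (by have := dist_triangle_right m x z; linarith)
      (by have := dist_triangle m x z; linarith)
    have hE2 := abs_cosine_le_one (a := dist m y) (b := dist m z) (c := dist y z) hb hc
      (dist_triangle_left _ _ _)
      (by have := dist_triangle_right m y z; linarith)
      (by have := dist_triangle m y z; linarith)
    set E₁ := (dist m x ^ 2 + dist m z ^ 2 - dist x z ^ 2) / (2 * dist m x * dist m z) with hE₁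
    set E₂ := (dist m y ^ 2 + dist m z ^ 2 - dist y z ^ 2) / (2 * dist m y * dist m z) with hE₂
    have key : E₁ + E₂ ≤ 0 := by
      by_contra! hpos
      obtain ⟨σ, hσ⟩ := hX.1 m trivial x trivial
      obtain ⟨τ, hτ⟩ := hX.1 m trivial y trivial
      obtain ⟨ω, hω⟩ := hX.1 m trivial z trivial
      obtain ⟨ε₁, hε₁, h₁⟩ := hX.exists_dist_sq_lt hκ hmx hmz hxz hσ hω
        (e := (3 * E₁ - E₂) / 4) (by linarith) (by linarith)
      obtain ⟨ε₂, hε₂, h₂⟩ := hX.exists_dist_sq_lt hκ hmy hmz hyz hτ hω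
        (e := (3 * E₂ - E₁) / 4) (by linarith) (by linarith)
      obtain ⟨s, hs0, hs⟩ := exists_between (show 0 < min (min ε₁ ε₂) (min a b) by positivity)
      simp only [lt_min_iff] at hs
      obtain ⟨⟨hs1, hs2⟩, hsa, hsb⟩ := hs
      set k := (E₁ + E₂) / 2 with hk
      have hk0 : 0 < k := by linarith
      have hk1 : k ≤ 1 := by linarith
      have hks : k * s ≤ s := by nlinarith
      have i1 := h₁ s (k * s) hs0 hs1 (by positivity) (by linarith)
      have i2 := h₂ s (k * s) hs0 hs2 (by positivity) (by linarith)
      have e1 : dist (σ s) x = a - s := by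
        have := hσ.2.2.1.2 s ⟨hs0.le, hsa.le⟩ a ⟨ha.le, le_rfl⟩
        rw [abs_of_nonpos (by linarith)] at this
        simp only [a, hσ.2.1] at this
        simp only [a]; linarith
      have e2 : dist (τ s) y = b - s := by
        have := hτ.2.2.1.2 s ⟨hs0.le, hsb.le⟩ b ⟨hb.le, le_rfl⟩
        rw [abs_of_nonpos (by linarith)] at this
        simp only [b, hτ.2.1] at this
        simp only [b]; linarith
      have i3 : 2 * s ≤ dist (σ s) (ω (k * s)) + dist (τ s) (ω (k * s)) := by
        have := dist_triangle4 x (σ s) (τ s) y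
        have := dist_triangle_right (σ s) (τ s) (ω (k * s))
        rw [dist_comm x (σ s)] at *
        linarith
      have i4 : (2 * s) ^ 2 ≤ (dist (σ s) (ω (k * s)) + dist (τ s) (ω (k * s))) ^ 2 := by
        gcongr
      have i5 : (2 * s) ^ 2 < 4 * (s ^ 2 * (1 + k ^ 2 - k * k)) := by
        have := sq_nonneg (dist (σ s) (ω (k * s)) - dist (τ s) (ω (k * s)))
        have : s ^ 2 * (1 + k ^ 2 - k * k) * 2 =
          s ^ 2 + (k * s) ^ 2 - 2 * s * (k * s) * ((3 * E₁ - E₂) / 4) +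
          (s ^ 2 + (k * s) ^ 2 - 2 * s * (k * s) * ((3 * E₂ - E₁) / 4)) := by
          rw [hk]; ring
        linarith
      nlinarith
    have q1 : E₁ * (2 * a * c) = a ^ 2 + c ^ 2 - dist x z ^ 2 := by
      exact div_mul_cancel₀ _ (by positivity)
    have q2 : E₂ * (2 * b * c) = b ^ 2 + c ^ 2 - dist y z ^ 2 := by
      exact div_mul_cancel₀ _ (by positivity)
    have q3 : (E₁ + E₂) * (2 * a * b * c) ≤ 0 :=
      mul_nonpos_of_nonpos_of_nonneg key (by positivity)
    have q4 : (E₁ + E₂) * (2 * a * b * c) =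
      b * (a ^ 2 + c ^ 2 - dist x z ^ 2) + a * (b ^ 2 + c ^ 2 - dist y z ^ 2) := by
      rw [← q1, ← q2]; ring
    rw [← hm, dist_comm z m, dist_comm z x, dist_comm z y]
    rw [← hcdef]
    nlinarith

/-- `m` lies on a geodesic from `x` to `y`. -/
abbrev Btw {X : Type*} [MetricSpace X] (x m y : X) : Prop := dist x m + dist m y = dist x y

theorem Btw.symm {X : Type*} [MetricSpace X] {x m y : X} (h : Btw x m y) : Btw y m x := by
  rw [Btw, dist_comm y m, dist_comm m x, dist_comm y x, ← h, add_comm]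

theorem Btw.trans {X : Type*} [MetricSpace X] {x m n y : X} (h : Btw x m y) (h' : Btw x n m) :
    Btw x n y := by
  have h1 := dist_triangle x n y
  have h2 := dist_triangle n m y
  unfold Btw at *
  linarith

theorem Btw.trans_right {X : Type*} [MetricSpace X] {x m n y : X} (h : Btw x m y)
    (h' : Btw x n m) : Btw n m y := by
  have h1 := dist_triangle x n y
  have h2 := dist_triangle n m y
  unfold Btw at *
  linarith

theorem Btw.exists_ratio {X : Type*} [MetricSpace X] {x m y : X} (h : Btw x m y) :
    ∃ τ, 0 ≤ τ ∧ τ ≤ 1 ∧ dist x m = τ * dist x y ∧ dist m y = (1 - τ) * dist x y := by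
  have h1 := dist_nonneg (x := x) (y := m)
  have h2 := dist_nonneg (x := m) (y := y)
  unfold Btw at h
  rcases eq_or_lt_of_le (dist_nonneg (x := x) (y := y)) with h0 | h0
  · exact ⟨0, le_rfl, zero_le_one, by linarith, by linarith⟩
  · refine ⟨dist x m / dist x y, by positivity, (div_le_one h0).2 (by linarith), ?_, ?_⟩ <;>
      field_simp
    linarith

namespace IsStewartSpace

variable {X : Type*} [MetricSpace X]

theorem stewart_ratio (hS : IsStewartSpace X) {x y m : X} {τ : ℝ} (h1 : dist x m = τ * dist x y)
    (h2 : dist m y = (1 - τ) * dist x y) (z : X) :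
    dist z m ^ 2 ≤ (1 - τ) * dist z x ^ 2 + τ * dist z y ^ 2
      - τ * (1 - τ) * dist x y ^ 2 := by
  rcases eq_or_lt_of_le (dist_nonneg (x := x) (y := y)) with h0 | h0
  · rw [← h0, mul_zero] at h1 h2
    rw [dist_eq_zero] at h1 h2
    subst h1 h2
    rw [dist_self]
    exact le_of_eq (by ring)
  · have h := hS.stewart x y m z (by rw [h1, h2]; ring)
    rw [h1, h2] at h
    refine le_of_mul_le_mul_left (h.trans_eq ?_) h0
    ring

theorem eq_of_btw (hS : IsStewartSpace X) {x y m m' : X} (h : Btw x m y) (h' : Btw x m' y)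
    (hd : dist x m = dist x m') : m = m' := by
  obtain ⟨τ, h0, h1, e1, e2⟩ := h.exists_ratio
  have h3 := hS.stewart_ratio e1 e2 m'
  have e3 : dist m' y = (1 - τ) * dist x y := by unfold Btw at *; linarith
  rw [dist_comm m' x, ← hd, e1, e3] at h3
  have h4 : dist m' m ^ 2 ≤ 0 := h3.trans (le_of_eq (by ring))
  exact (dist_eq_zero.1 (pow_eq_zero_iff two_ne_zero |>.1 (le_antisymm h4 (sq_nonneg _)))).symm

theorem fork (hS : IsStewartSpace X) {o z z' x x' : X} {τ : ℝ} (h0 : 0 ≤ τ)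
    (h1 : dist o x = τ * dist o z) (h2 : dist x z = (1 - τ) * dist o z)
    (h1' : dist o x' = τ * dist o z') (h2' : dist x' z' = (1 - τ) * dist o z') :
    dist x x' ≤ τ * dist z z' := by
  have i1 := hS.stewart_ratio h1 h2 z'
  have i2 := hS.stewart_ratio h1' h2' x
  rw [dist_comm x o, h1] at i2
  rw [dist_comm z' x, dist_comm z' o, dist_comm z' z] at i1
  refine abs_le_of_sq_le_sq (a := dist x x') ?_ (by positivity) |> fun h => (le_abs_self _).trans h
  nlinarith [mul_le_mul_of_nonneg_left i1 h0]

theorem dist_le_of_ratio (hS : IsStewartSpace X) {x y m : X} {τ : ℝ} (h0 : 0 ≤ τ) (h1 : τ ≤ 1)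
    (e1 : dist x m = τ * dist x y) (e2 : dist m y = (1 - τ) * dist x y) (v : X) :
    dist v m ≤ (1 - τ) * dist v x + τ * dist v y := by
  have i := hS.stewart_ratio e1 e2 v
  have h1' : 0 ≤ 1 - τ := by linarith
  have d1 := dist_triangle_left x y v
  have d2 := dist_triangle v x y
  have d3 := dist_triangle v y x
  rw [dist_comm y x] at d3
  have d4 : (dist v x - dist v y) ^ 2 ≤ dist x y ^ 2 :=
    sq_le_sq' (by linarith) (by linarith)
  refine abs_le_of_sq_le_sq (a := dist v m) ?_ (by positivity) |> fun h => (le_abs_self _).trans h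
  nlinarith [mul_le_mul_of_nonneg_left d4 (mul_nonneg h0 h1')]

theorem exists_ratio (hS : IsStewartSpace X) (x y : X) {τ : ℝ} (h0 : 0 ≤ τ) (h1 : τ ≤ 1) :
    ∃ m, dist x m = τ * dist x y ∧ dist m y = (1 - τ) * dist x y := by
  obtain ⟨m, hm, hm'⟩ := hS.exists_dist_eq x y (τ * dist x y) (by positivity)
    (mul_le_of_le_one_left dist_nonneg h1)
  exact ⟨m, hm, by rw [hm']; ring⟩

theorem infDist_le_of_ratio (hS : IsStewartSpace X)
    {C : Set X} (hC : ∀ x ∈ C, ∀ y ∈ C, ∀ m, Btw x m y → m ∈ C)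
    (hne : C.Nonempty) {x y m : X} {τ : ℝ} (h0 : 0 ≤ τ) (h1 : τ ≤ 1)
    (e1 : dist x m = τ * dist x y) (e2 : dist m y = (1 - τ) * dist x y) :
    infDist m C ≤ (1 - τ) * infDist x C + τ * infDist y C := by
  refine le_of_forall_pos_le_add fun ε hε => ?_
  obtain ⟨x', hx', hxx⟩ := (infDist_lt_iff hne).1 (lt_add_of_pos_right (infDist x C) hε)
  obtain ⟨y', hy', hyy⟩ := (infDist_lt_iff hne).1 (lt_add_of_pos_right (infDist y C) hε)
  obtain ⟨n, hn1, hn2⟩ := hS.exists_ratio x y' h0 h1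
  obtain ⟨m', hm1, hm2⟩ := hS.exists_ratio x' y' h0 h1
  have hm' : m' ∈ C := hC x' hx' y' hy' m' (by rw [Btw, hm1, hm2]; ring)
  have f1 := hS.fork h0 e1 e2 hn1 hn2
  have f2 := hS.fork (o := y') (z := x) (z' := x') (x := n) (x' := m') (τ := 1 - τ)
    (by linarith) (by rw [dist_comm, hn2, dist_comm x]) (by rw [dist_comm n, hn1, dist_comm x]; ring)
    (by rw [dist_comm, hm2, dist_comm x']) (by rw [dist_comm m', hm1, dist_comm x']; ring)
  have := infDist_le_dist_of_mem (x := m) hm'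
  have := dist_triangle m n m'
  have : (1 - τ) * dist x x' ≤ (1 - τ) * (infDist x C + ε) := by
    have : 0 ≤ 1 - τ := by linarith
    gcongr
  have : τ * dist y y' ≤ τ * (infDist y C + ε) := by gcongr
  linarith

/-- The point at distance `r` from `o` on the geodesic from `o` to `z`
(and the point `z` itself if it is closer to `o`). -/
noncomputable def pt (hS : IsStewartSpace X) (o z : X) (r : ℝ) : X :=
  Classical.choose (hS.exists_dist_eq o z (max 0 (min r (dist o z))) (le_max_left _ _)
    (max_le dist_nonneg (min_le_right _ _)))

theorem dist_pt_max (hS : IsStewartSpace X) (o z : X) (r : ℝ) :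
    dist o (hS.pt o z r) = max 0 (min r (dist o z)) :=
  (Classical.choose_spec (hS.exists_dist_eq o z (max 0 (min r (dist o z))) (le_max_left _ _)
    (max_le dist_nonneg (min_le_right _ _)))).1

theorem btw_pt (hS : IsStewartSpace X) (o z : X) (r : ℝ) : Btw o (hS.pt o z r) z := by
  have h := Classical.choose_spec (hS.exists_dist_eq o z (max 0 (min r (dist o z)))
    (le_max_left _ _) (max_le dist_nonneg (min_le_right _ _)))
  have h2 : dist (hS.pt o z r) z = _ := h.2
  rw [Btw, hS.dist_pt_max, h2]
  ring

theorem dist_pt (hS : IsStewartSpace X) {o z : X} {r : ℝ} (h0 : 0 ≤ r) (h1 : r ≤ dist o z) :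
    dist o (hS.pt o z r) = r := by
  rw [hS.dist_pt_max, min_eq_left h1, max_eq_right h0]

theorem dist_pt_right (hS : IsStewartSpace X) {o z : X} {r : ℝ} (h0 : 0 ≤ r) (h1 : r ≤ dist o z) :
    dist (hS.pt o z r) z = dist o z - r := by
  have := hS.btw_pt o z r
  rw [Btw, hS.dist_pt h0 h1] at this
  linarith

theorem eq_pt (hS : IsStewartSpace X) {o m z : X} (h : Btw o m z) : hS.pt o z (dist o m) = m :=
  hS.eq_of_btw (hS.btw_pt _ _ _) h (hS.dist_pt dist_nonneg (by
    have := dist_nonneg (x := m) (y := z)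
    unfold Btw at h
    linarith))

theorem pt_of_dist_le (hS : IsStewartSpace X)
    {o z : X} {r : ℝ} (h : dist o z ≤ r) : hS.pt o z r = z :=
  hS.eq_of_btw (hS.btw_pt _ _ _) (by simp [Btw]) (by
    rw [hS.dist_pt_max, min_eq_right h, max_eq_right dist_nonneg])

theorem pt_zero (hS : IsStewartSpace X) (o z : X) : hS.pt o z 0 = o :=
  (dist_eq_zero.1 (hS.dist_pt le_rfl dist_nonneg)).symm

theorem dist_pt_le_dist (hS : IsStewartSpace X)
    {o z : X} {r : ℝ} : dist o (hS.pt o z r) ≤ dist o z := by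
  rw [hS.dist_pt_max]
  exact max_le dist_nonneg (min_le_right _ _)

theorem pt_pt (hS : IsStewartSpace X) {o z : X} {r r' : ℝ} (h0 : 0 ≤ r) (h : r ≤ r') :
    hS.pt o (hS.pt o z r') r = hS.pt o z r := by
  refine hS.eq_of_btw (Btw.trans (hS.btw_pt _ _ _) (hS.btw_pt o _ r)) (hS.btw_pt _ _ _) ?_
  rw [hS.dist_pt_max, hS.dist_pt_max, hS.dist_pt_max, max_eq_right (le_min (h0.trans h) dist_nonneg),
    ← min_assoc, min_eq_left h]

theorem dist_pt_pt_le (hS : IsStewartSpace X) {o z : X} {r r' : ℝ} (h0 : 0 ≤ r) (h : r ≤ r') :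
    dist (hS.pt o z r) (hS.pt o z r') ≤ r' - r := by
  rw [← hS.pt_pt h0 h]
  have h1 := hS.btw_pt o (hS.pt o z r') r
  rw [Btw, hS.dist_pt_max, max_eq_right (le_min h0 dist_nonneg)] at h1
  have h2 : dist o (hS.pt o z r') ≤ r' := by
    rw [hS.dist_pt_max]
    exact max_le (h0.trans h) (min_le_left _ _)
  rcases min_cases r (dist o (hS.pt o z r')) with h3 | h3 <;> linarith

theorem continuousOn_pt (hS : IsStewartSpace X)
    (o z : X) : ContinuousOn (fun r => hS.pt o z r) (Ici 0) := by
  have : LipschitzOnWith 1 (fun r => hS.pt o z r) (Ici 0) := by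
    refine LipschitzOnWith.of_dist_le_mul fun r hr r' hr' => ?_
    rw [NNReal.coe_one, one_mul, Real.dist_eq]
    rcases le_total r r' with h | h
    · rw [abs_sub_comm]
      exact (hS.dist_pt_pt_le hr h).trans (le_abs_self _)
    · rw [dist_comm]
      exact (hS.dist_pt_pt_le hr' h).trans (le_abs_self _)
  exact this.continuousOn

theorem dist_pt_sq (hS : IsStewartSpace X)
    {o z : X} {r : ℝ} (h0 : 0 ≤ r) (h1 : r ≤ dist o z) (v : X) :
    dist o z * dist v (hS.pt o z r) ^ 2 ≤ (dist o z - r) * dist v o ^ 2 + r * dist v z ^ 2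
      - r * (dist o z - r) * dist o z := by
  have := hS.stewart o z _ v (hS.btw_pt o z r)
  rwa [hS.dist_pt h0 h1, hS.dist_pt_right h0 h1] at this

theorem dist_pt_pt_le_dist (hS : IsStewartSpace X) (o z z' : X) {r : ℝ} (h0 : 0 ≤ r) :
    dist (hS.pt o z r) (hS.pt o z' r) ≤ dist z z' := by
  have key : ∀ z z' : X, r ≤ dist o z → dist o z' < r →
      dist (hS.pt o z r) (hS.pt o z' r) ≤ dist z z' := by
    intro z z' h1 h2
    rw [hS.pt_of_dist_le h2.le, dist_comm, dist_comm z]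
    have h3 := hS.dist_pt_sq h0 h1 z'
    have h4 : 0 < dist o z := lt_of_lt_of_le (lt_of_le_of_lt dist_nonneg h2) h1
    refine (le_abs_self _).trans (abs_le_of_sq_le_sq ?_ dist_nonneg)
    refine le_of_mul_le_mul_left (h3.trans ?_) h4
    rw [dist_comm z' o]
    have h5 : 0 ≤ (dist o z - r) * (r * dist o z - dist o z' ^ 2) := by
      refine mul_nonneg (by linarith) ?_
      have := dist_nonneg (x := o) (y := z')
      nlinarith
    have h6 : r * dist z' z ^ 2 ≤ dist o z * dist z' z ^ 2 := by gcongr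
    linarith
  rcases le_or_gt r (dist o z) with h1 | h1 <;> rcases le_or_gt r (dist o z') with h2 | h2
  · rcases eq_or_lt_of_le h0 with rfl | h0'
    · rw [hS.pt_zero, hS.pt_zero, dist_self]
      exact dist_nonneg
    have h3 := hS.dist_pt_sq h0 h1 z'
    have h4 := hS.dist_pt_sq h0 h2 (hS.pt o z r)
    rw [dist_comm (hS.pt o z r) o, hS.dist_pt h0 h1] at h4
    rw [dist_comm z' (hS.pt o z r), dist_comm z' o, dist_comm z' z] at h3
    set a := dist o z
    set b := dist o z'
    have ha : 0 < a := by linarith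
    have hb : 0 < b := by linarith
    refine (le_abs_self _).trans (abs_le_of_sq_le_sq ?_ dist_nonneg)
    have h5 : a * b * dist (hS.pt o z r) (hS.pt o z' r) ^ 2
        ≤ r ^ 2 * (dist z z' ^ 2 - (a - b) ^ 2) := by
      nlinarith [mul_le_mul_of_nonneg_left h3 h0, mul_le_mul_of_nonneg_left h4 ha.le]
    have h6 : r ^ 2 * (dist z z' ^ 2 - (a - b) ^ 2) ≤ r ^ 2 * dist z z' ^ 2 := by
      gcongr
      linarith [sq_nonneg (a - b)]
    have h7 : r ^ 2 * dist z z' ^ 2 ≤ a * b * dist z z' ^ 2 := by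
      gcongr
      nlinarith
    exact le_of_mul_le_mul_left (h5.trans (h6.trans h7)) (mul_pos ha hb)
  · exact key _ _ h1 h2
  · rw [dist_comm, dist_comm z]
    exact key _ _ h2 h1
  · rw [hS.pt_of_dist_le h1.le, hS.pt_of_dist_le h2.le]

theorem lipschitzWith_pt (hS : IsStewartSpace X) (o : X) {r : ℝ} (h0 : 0 ≤ r) :
    LipschitzWith 1 (fun z => hS.pt o z r) :=
  LipschitzWith.of_dist_le_mul fun z z' => by
    simpa using hS.dist_pt_pt_le_dist o z z' h0

theorem continuous_pt (hS : IsStewartSpace X)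
    (o : X) {r : ℝ} (h0 : 0 ≤ r) : Continuous (fun z => hS.pt o z r) :=
  (hS.lipschitzWith_pt o h0).continuous

theorem joinedIn_of_btw (hS : IsStewartSpace X) {A : Set X} {x y : X} (h : ∀ m, Btw x m y → m ∈ A) :
    JoinedIn A x y := by
  refine JoinedIn.ofLine (f := fun t => hS.pt x y (t * dist x y)) ?_ ?_ ?_ ?_
  · refine (hS.continuousOn_pt x y).comp (by fun_prop) fun t ht => ?_
    exact mul_nonneg ht.1 dist_nonneg
  · simp [hS.pt_zero]
  · simp only [one_mul]
    exact hS.pt_of_dist_le le_rfl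
  · rintro _ ⟨t, -, rfl⟩
    exact h _ (hS.btw_pt _ _ _)

end IsStewartSpace

theorem IsCATSpace.mem_of_btw {κ : ℝ} (hκ : κ ≤ 0) {X : Type*} [MetricSpace X]
    (hX : IsCATSpace κ X) {C : Set X} (hC : ConvexWrt (xDist X) C) {x y m : X}
    (hx : x ∈ C) (hy : y ∈ C) (hm : Btw x m y) : m ∈ C := by
  obtain ⟨f, hf⟩ := hX.1 x trivial y trivial
  have h0 : dist x m ≤ dist x y := by
    have := dist_nonneg (x := m) (y := y)
    unfold Btw at hm
    linarith
  have d1 : dist x (f (dist x m)) = dist x m := by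
    have := hf.2.2.1.2 0 ⟨le_rfl, dist_nonneg⟩ (dist x m) ⟨dist_nonneg, h0⟩
    simpa [hf.1] using this
  have d2 : dist (f (dist x m)) y = dist x y - dist x m := by
    have := hf.2.2.1.2 (dist x m) ⟨dist_nonneg, h0⟩ (dist x y) ⟨dist_nonneg, le_rfl⟩
    rw [hf.2.1, abs_of_nonpos (by linarith)] at this
    linarith
  have h1 : f (dist x m) = m :=
    (hX.isStewartSpace hκ).eq_of_btw (x := x) (y := y) (by rw [Btw, d1, d2]; ring) hm d1
  refine hC x hx y hy (mem_iUnion₂.2 ⟨f, hf, dist x m, ⟨dist_nonneg, h0⟩, h1⟩)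

section

open MeasureTheory Topology

/-- Almost every fiber in `A` of a Lipschitz map to the plane is finite. -/
def HasFiniteFibers {X : Type*} [MetricSpace X] (A : Set X) : Prop :=
  ∀ (K : NNReal) (g : X → ℝ × ℝ), LipschitzWith K g → ∀ᵐ w : ℝ × ℝ, (A ∩ g ⁻¹' {w}).Finite

theorem HasFiniteFibers.mono {X : Type*} [MetricSpace X] {A B : Set X} (hB : HasFiniteFibers B)
    (h : A ⊆ B) : HasFiniteFibers A := fun K g hg => by
  filter_upwards [hB K g hg] with w hw
  exact hw.subset (inter_subset_inter_left _ h)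

theorem HasFiniteFibers.union {X : Type*} [MetricSpace X] {A B : Set X} (hA : HasFiniteFibers A)
    (hB : HasFiniteFibers B) : HasFiniteFibers (A ∪ B) := fun K g hg => by
  filter_upwards [hA K g hg, hB K g hg] with w hw hw'
  rw [union_inter_distrib_right]
  exact hw.union hw'

theorem hasFiniteFibers_of_finite {X : Type*} [MetricSpace X] {A : Set X} (hA : A.Finite) :
    HasFiniteFibers A := fun _ _ _ => Eventually.of_forall fun _ => hA.subset inter_subset_left

theorem hasFiniteFibers_biUnion {X ι : Type*} [MetricSpace X] {S : Set ι} (hS : S.Finite)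
    {A : ι → Set X} (hA : ∀ i ∈ S, HasFiniteFibers (A i)) : HasFiniteFibers (⋃ i ∈ S, A i) :=
  fun K g hg => by
  have := (ae_ball_iff hS.countable).2 fun i hi => hA i hi K g hg
  filter_upwards [this] with w hw
  rw [iUnion₂_inter]
  exact hS.biUnion fun i hi => hw i hi

/-- The index of the dyadic square of side `2⁻ⁿ` containing a point of the plane. -/
noncomputable def dyadicIndex (n : ℕ) (u : ℝ × ℝ) : ℤ × ℤ := (⌊2 ^ n * u.1⌋, ⌊2 ^ n * u.2⌋)

theorem dist_le_of_dyadicIndex_eq {n : ℕ} {u v : ℝ × ℝ} (h : dyadicIndex n u = dyadicIndex n v) :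
    dist u v ≤ (1 / 2) ^ n := by
  have key : ∀ a b : ℝ, ⌊2 ^ n * a⌋ = ⌊2 ^ n * b⌋ → |a - b| ≤ (1 / 2) ^ n := by
    intro a b hab
    have := Int.abs_sub_lt_one_of_floor_eq_floor hab
    rw [← mul_sub, abs_mul, abs_of_pos (by positivity)] at this
    rw [div_pow, one_pow, le_div_iff₀ (by positivity), mul_comm]
    exact this.le
  simp only [dyadicIndex, Prod.mk.injEq] at h
  rw [Prod.dist_eq, Real.dist_eq, Real.dist_eq]
  exact max_le (key _ _ h.1) (key _ _ h.2)

theorem dyadicIndex_mem {n M : ℕ} {u : ℝ × ℝ} (hu : ‖u‖ ≤ M) :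
    dyadicIndex n u ∈ Finset.Icc (-(M * 2 ^ n : ℤ)) (M * 2 ^ n) ×ˢ
      Finset.Icc (-(M * 2 ^ n : ℤ)) (M * 2 ^ n) := by
  have key : ∀ a : ℝ, |a| ≤ M → ⌊2 ^ n * a⌋ ∈ Finset.Icc (-(M * 2 ^ n : ℤ)) (M * 2 ^ n) := by
    intro a ha
    rw [abs_le] at ha
    have h2 : (0 : ℝ) < 2 ^ n := by positivity
    rw [Finset.mem_Icc]
    constructor
    · rw [Int.le_floor]; push_cast; nlinarith
    · have : (⌊2 ^ n * a⌋ : ℝ) ≤ M * 2 ^ n := (Int.floor_le _).trans (by nlinarith)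
      exact_mod_cast this
  rw [Finset.mem_product]
  exact ⟨key _ ((norm_fst_le u).trans hu), key _ ((norm_snd_le u).trans hu)⟩

/-- A set with a bounded image under a map to the plane whose inverse is Lipschitz has finite
fibers. -/
theorem hasFiniteFibers_of_chart {X : Type*} [MetricSpace X] {A : Set X} {f : X → ℝ × ℝ}
    {C : ℝ} (hC : 0 ≤ C) (hf : ∀ x ∈ A, ∀ y ∈ A, dist x y ≤ C * dist (f x) (f y)) {M : ℕ}
    (hM : ∀ x ∈ A, ‖f x‖ ≤ M) : HasFiniteFibers A := by
  classical
  intro K g hg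
  set I : ℕ → Finset (ℤ × ℤ) := fun n => Finset.Icc (-(M * 2 ^ n : ℤ)) (M * 2 ^ n) ×ˢ
      Finset.Icc (-(M * 2 ^ n : ℤ)) (M * 2 ^ n) with hI
  set S : ℕ → ℤ × ℤ → Set X := fun n i => {x ∈ A | dyadicIndex n (f x) = i} with hSdef
  set U : ℕ → ℤ × ℤ → Set (ℝ × ℝ) := fun n i =>
    if h : (S n i).Nonempty then closedBall (g h.some) (K * (C * (1 / 2) ^ n)) else ∅ with hU
  have hUm : ∀ n i, MeasurableSet (U n i) := by
    intro n i
    simp only [hU]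
    split_ifs
    · exact isClosed_closedBall.measurableSet
    · exact MeasurableSet.empty
  have hUmem : ∀ n, ∀ x ∈ A, g x ∈ U n (dyadicIndex n (f x)) := by
    intro n x hx
    have hne : (S n (dyadicIndex n (f x))).Nonempty := ⟨x, hx, rfl⟩
    simp only [hU, dif_pos hne]
    have h1 := hne.some_mem
    rw [mem_closedBall]
    refine (hg.dist_le_mul _ _).trans ?_
    gcongr
    refine (hf x hx _ h1.1).trans ?_
    gcongr
    exact dist_le_of_dyadicIndex_eq h1.2.symm
  have hUvol : ∀ n i, volume (U n i) ≤ ENNReal.ofReal ((2 * (K * (C * (1 / 2) ^ n))) ^ 2) := by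
    intro n i
    simp only [hU]
    split_ifs with h
    · rw [← closedBall_prod_same, Measure.volume_eq_prod, Measure.prod_prod,
        Real.volume_closedBall, Real.volume_closedBall, ← ENNReal.ofReal_mul (by positivity), sq]
    · simp
  set F : ℕ → ℝ × ℝ → ENNReal := fun n w => ∑ i ∈ I n, (U n i).indicator 1 w with hF
  have hFm : ∀ n, Measurable (F n) := fun n =>
    Finset.measurable_fun_sum _ fun i _ => measurable_one.indicator (hUm n i)
  have hFint : ∀ n, ∫⁻ w, F n w ≤ ENNReal.ofReal ((2 * M + 1) ^ 2 * (2 * (K * C)) ^ 2) := by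
    intro n
    rw [lintegral_finsetSum _ fun i _ => measurable_one.indicator (hUm n i)]
    calc ∑ i ∈ I n, ∫⁻ w, (U n i).indicator 1 w
        = ∑ i ∈ I n, volume (U n i) := by
          refine Finset.sum_congr rfl fun i _ => lintegral_indicator_one (hUm n i)
      _ ≤ ∑ i ∈ I n, ENNReal.ofReal ((2 * (K * (C * (1 / 2) ^ n))) ^ 2) :=
          Finset.sum_le_sum fun i _ => hUvol n i
      _ ≤ ENNReal.ofReal ((2 * M + 1) ^ 2 * (2 * (K * C)) ^ 2) := by
          rw [Finset.sum_const, ← ENNReal.ofReal_nsmul]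
          apply ENNReal.ofReal_le_ofReal
          have hc : ((I n).card : ℝ) = (2 * M * 2 ^ n + 1) ^ 2 := by
            have : ((M * 2 ^ n : ℤ) + 1 - -(M * 2 ^ n : ℤ)).toNat = 2 * M * 2 ^ n + 1 := by
              have : ((M * 2 ^ n : ℤ) + 1 - -(M * 2 ^ n : ℤ)) = ((2 * M * 2 ^ n + 1 : ℕ) : ℤ) := by
                push_cast; ring
              rw [this, Int.toNat_natCast]
            simp only [hI, Finset.card_product, Int.card_Icc, this]
            push_cast; ring
          rw [nsmul_eq_mul, hc]
          have h1 : (1 : ℝ) ≤ 2 ^ n := one_le_pow₀ (by norm_num)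
          have h2 : (2 * M * 2 ^ n + 1 : ℝ) ^ 2 ≤ ((2 * M + 1) * 2 ^ n) ^ 2 := by
            gcongr
            linarith
          calc (2 * M * 2 ^ n + 1 : ℝ) ^ 2 * (2 * (K * (C * (1 / 2) ^ n))) ^ 2
              ≤ ((2 * M + 1) * 2 ^ n) ^ 2 * (2 * (K * (C * (1 / 2) ^ n))) ^ 2 := by gcongr
            _ = (2 * M + 1) ^ 2 * (2 * (K * C)) ^ 2 * (2 ^ n * (1 / 2) ^ n) ^ 2 := by ring
            _ = _ := by rw [← mul_pow 2 (1 / 2 : ℝ) n]; norm_num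
  have hfin : ∀ᵐ w, liminf (fun n => F n w) atTop < ⊤ := by
    refine ae_lt_top (.liminf hFm) (ne_top_of_le_ne_top (ENNReal.ofReal_ne_top
      (r := (2 * M + 1) ^ 2 * (2 * (K * C)) ^ 2)) ?_)
    refine (lintegral_liminf_le hFm).trans ?_
    exact liminf_le_of_le (by isBoundedDefault) fun b hb => by
      obtain ⟨n, hn⟩ := hb.exists
      exact hn.trans (hFint n)
  filter_upwards [hfin] with w hw
  by_contra hinf
  obtain ⟨N, hN⟩ := ENNReal.exists_nat_gt hw.ne
  have hfreq := frequently_lt_of_liminf_lt (by isBoundedDefault) hN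
  obtain ⟨T, hT, hTcard⟩ := Set.Infinite.exists_subset_card_eq hinf N
  have hsep : ∀ᶠ n : ℕ in atTop, ∀ x ∈ T, ∀ y ∈ T, x ≠ y →
      dyadicIndex n (f x) ≠ dyadicIndex n (f y) := by
    rw [eventually_all_finset]
    intro x hx
    rw [eventually_all_finset]
    intro y hy
    rcases eq_or_ne x y with rfl | hxy
    · simp
    have hpos : 0 < dist (f x) (f y) := by
      by_contra! h
      have h' := hf x (hT hx).1 y (hT hy).1
      rw [le_antisymm h dist_nonneg, mul_zero] at h'
      exact hxy (dist_le_zero.1 h')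
    have ht : Tendsto (fun n : ℕ => (1 / 2 : ℝ) ^ n) atTop (𝓝 0) :=
      tendsto_pow_atTop_nhds_zero_of_lt_one (by norm_num) (by norm_num)
    filter_upwards [ht.eventually_lt_const hpos] with n hn _ he
    exact absurd (dist_le_of_dyadicIndex_eq he) (not_le.2 hn)
  obtain ⟨n, hn, hn'⟩ := (hfreq.and_eventually hsep).exists
  refine absurd hn (not_lt.2 ?_)
  set J := T.image fun x => dyadicIndex n (f x)
  have hJc : J.card = N := by
    rw [← hTcard]
    refine Finset.card_image_of_injOn fun x hx y hy hxy => ?_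
    by_contra hne
    exact hn' x hx y hy hne hxy
  have hJI : J ⊆ I n := by
    intro i hi
    obtain ⟨x, hx, rfl⟩ := Finset.mem_image.1 hi
    exact dyadicIndex_mem (hM x (hT hx).1)
  calc (N : ENNReal) = ∑ i ∈ J, 1 := by simp [hJc]
    _ = ∑ i ∈ J, (U n i).indicator 1 w := by
        refine Finset.sum_congr rfl fun i hi => ?_
        obtain ⟨x, hx, rfl⟩ := Finset.mem_image.1 hi
        have h1 := hUmem n x (hT hx).1
        rw [show g x = w from (hT hx).2] at h1
        rw [indicator_of_mem h1, Pi.one_apply]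
    _ ≤ F n w := Finset.sum_le_sum_of_subset hJI

theorem one_add_sq_div_two_le_cosh (t : ℝ) : 1 + t ^ 2 / 2 ≤ Real.cosh t := by
  have h := sum_le_hasSum (Finset.range 2) (fun n _ => by
    rw [pow_mul]; positivity) (Real.hasSum_cosh t)
  simpa [Finset.sum_range_succ] using h

theorem one_le_lorentz (u v : ℝ × ℝ) :
    1 ≤ Real.sqrt (1 + u.1 ^ 2 + u.2 ^ 2) * Real.sqrt (1 + v.1 ^ 2 + v.2 ^ 2) -
        u.1 * v.1 - u.2 * v.2 := by
  rw [← Real.sqrt_mul (by positivity)]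
  have : 1 + u.1 * v.1 + u.2 * v.2 ≤
      Real.sqrt ((1 + u.1 ^ 2 + u.2 ^ 2) * (1 + v.1 ^ 2 + v.2 ^ 2)) := by
    apply Real.le_sqrt_of_sq_le
    nlinarith [sq_nonneg (u.1 - v.1), sq_nonneg (u.2 - v.2), sq_nonneg (u.1 * v.2 - u.2 * v.1)]
  linarith

theorem lorentz_le (u v : ℝ × ℝ) :
    Real.sqrt (1 + u.1 ^ 2 + u.2 ^ 2) * Real.sqrt (1 + v.1 ^ 2 + v.2 ^ 2) -
        u.1 * v.1 - u.2 * v.2 ≤ 1 + ((u.1 - v.1) ^ 2 + (u.2 - v.2) ^ 2) / 2 := by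
  have h1 := Real.sq_sqrt (show 0 ≤ 1 + u.1 ^ 2 + u.2 ^ 2 by positivity)
  have h2 := Real.sq_sqrt (show 0 ≤ 1 + v.1 ^ 2 + v.2 ^ 2 by positivity)
  nlinarith [sq_nonneg (Real.sqrt (1 + u.1 ^ 2 + u.2 ^ 2) - Real.sqrt (1 + v.1 ^ 2 + v.2 ^ 2))]

theorem sq_add_sq_le_dist (u v : ℝ × ℝ) :
    (u.1 - v.1) ^ 2 + (u.2 - v.2) ^ 2 ≤ 2 * dist u v ^ 2 := by
  have h1 : |u.1 - v.1| ≤ dist u v := by rw [Prod.dist_eq, ← Real.dist_eq]; exact le_max_left _ _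
  have h2 : |u.2 - v.2| ≤ dist u v := by rw [Prod.dist_eq, ← Real.dist_eq]; exact le_max_right _ _
  have h3 := sq_le_sq' (by linarith [abs_le.1 h1]) (abs_le.1 h1).2
  have h4 := sq_le_sq' (by linarith [abs_le.1 h2]) (abs_le.1 h2).2
  linarith

theorem exists_mDist_le (κ : ℝ) :
    ∃ K : ℝ, 0 ≤ K ∧ ∀ u v, mDist κ u v ≤ K * dist u v := by
  by_cases h : κ = 0
  · refine ⟨2, by norm_num, fun u v => ?_⟩
    rw [mDist, if_pos h]
    have := sq_add_sq_le_dist u v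
    apply Real.sqrt_le_iff.2 ⟨by positivity, ?_⟩
    nlinarith [sq_nonneg (dist u v)]
  · refine ⟨1 / Real.sqrt (-κ) * 2, by positivity, fun u v => ?_⟩
    rw [mDist, if_neg h, mul_assoc]
    gcongr
    have h1 := one_le_lorentz u v
    have h2 := lorentz_le u v
    have h3 := sq_add_sq_le_dist u v
    have h4 := one_add_sq_div_two_le_cosh (2 * dist u v)
    have h5 : 0 ≤ 2 * dist u v := by positivity
    rw [← Real.arcosh_cosh h5]
    exact (Real.arcosh_le_arcosh (by linarith) (by linarith [Real.one_le_cosh (2 * dist u v)])).2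
      (by nlinarith [sq_nonneg (dist u v)])

theorem exists_norm_le_of_mDist_le (κ : ℝ) (hκ : κ ≤ 0) (v : ℝ × ℝ) (R : ℝ) :
    ∃ M : ℕ, ∀ u, mDist κ u v ≤ R → ‖u‖ ≤ M := by
  suffices h : ∃ M : ℝ, ∀ u, mDist κ u v ≤ R → ‖u‖ ≤ M by
    obtain ⟨M, hM⟩ := h
    obtain ⟨N, hN⟩ := exists_nat_ge M
    exact ⟨N, fun u hu => (hM u hu).trans hN⟩
  by_cases h : κ = 0
  · refine ⟨R + ‖v‖, fun u hu => ?_⟩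
    rw [mDist, if_pos h] at hu
    have h1 : ‖u - v‖ ≤ R := by
      refine le_trans ?_ hu
      rw [Prod.norm_def]
      refine max_le ?_ ?_ <;> rw [Real.norm_eq_abs] <;> apply Real.abs_le_sqrt
      · simp; positivity
      · simp; positivity
    have := norm_le_norm_add_norm_sub' u v
    linarith
  · have hk : 0 < Real.sqrt (-κ) := Real.sqrt_pos.2 (by
      rcases lt_or_eq_of_le hκ with h' | h'
      · linarith
      · exact absurd h' h)
    set n := Real.sqrt (v.1 ^ 2 + v.2 ^ 2) with hn
    set w := Real.sqrt (1 + v.1 ^ 2 + v.2 ^ 2) with hw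
    have hn2 : n ^ 2 = v.1 ^ 2 + v.2 ^ 2 := Real.sq_sqrt (by positivity)
    have hnw : 0 < w - n := sub_pos.2 (Real.sqrt_lt_sqrt (by positivity) (by linarith))
    refine ⟨Real.cosh (Real.sqrt (-κ) * R) / (w - n), fun u hu => ?_⟩
    rw [mDist, if_neg h, one_div, inv_mul_le_iff₀ hk] at hu
    set B := Real.sqrt (1 + u.1 ^ 2 + u.2 ^ 2) * w - u.1 * v.1 - u.2 * v.2 with hB
    have hB1 : 1 ≤ B := one_le_lorentz u v
    have hBle : B ≤ Real.cosh (Real.sqrt (-κ) * R) := by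
      rw [← Real.cosh_arcosh hB1]
      rw [Real.cosh_le_cosh]
      have h0 : 0 ≤ Real.arcosh B := Real.arcosh_nonneg hB1
      rw [abs_of_nonneg h0]
      exact (show Real.arcosh B ≤ _ from hu).trans (le_abs_self _)
    set U := Real.sqrt (1 + u.1 ^ 2 + u.2 ^ 2) with hU
    have hU2 : U ^ 2 = 1 + u.1 ^ 2 + u.2 ^ 2 := Real.sq_sqrt (by positivity)
    have hcs : u.1 * v.1 + u.2 * v.2 ≤ U * n := by
      refine (le_abs_self _).trans (abs_le_of_sq_le_sq ?_ (by positivity))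
      rw [mul_pow, hU2, hn2]
      nlinarith [sq_nonneg (u.1 * v.2 - u.2 * v.1), sq_nonneg v.1, sq_nonneg v.2]
    rw [le_div_iff₀ hnw]
    have huU : ‖u‖ ≤ U := by
      rw [Prod.norm_def]
      refine max_le ?_ ?_ <;> rw [Real.norm_eq_abs] <;> apply Real.abs_le_sqrt
      · nlinarith [sq_nonneg u.2]
      · nlinarith [sq_nonneg u.1]
    calc ‖u‖ * (w - n) ≤ U * (w - n) := by gcongr
      _ ≤ B := by rw [hB]; linarith
      _ ≤ _ := hBle

theorem PolyComplex2.exists_hasFiniteFibers {κ : ℝ} (hκ : κ ≤ 0) {X : Type*} [MetricSpace X]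
    (PC : PolyComplex2 κ X) (p : X) : ∃ R > 0, HasFiniteFibers (ball p R) := by
  obtain ⟨R, hR, hfin, hfinv⟩ := PC.locally_finite p
  refine ⟨R, hR, ?_⟩
  have hcell : ∀ c, (c ∈ PC.faces ∨ c ∈ PC.edges) → HasFiniteFibers (c ∩ ball p R) := by
    rintro c (hc | hc)
    · obtain ⟨f, P, -, -, -, -, hd⟩ := PC.face_chart c hc
      rcases (c ∩ ball p R).eq_empty_or_nonempty with he | ⟨x₀, hx₀, hx₀'⟩
      · rw [he]; exact hasFiniteFibers_of_finite finite_empty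
      obtain ⟨K, hK, hKle⟩ := exists_mDist_le κ
      obtain ⟨M, hM⟩ := exists_norm_le_of_mDist_le κ hκ (f x₀) (R + R)
      refine hasFiniteFibers_of_chart (f := f) hK (fun x hx y hy => ?_) (M := M) fun x hx => ?_
      · rw [← hd x (subset_closure hx.1) y (subset_closure hy.1)]
        exact hKle _ _
      · apply hM
        rw [hd x (subset_closure hx.1) x₀ (subset_closure hx₀)]
        have h1 := mem_ball.1 hx.2
        have h2 := mem_ball.1 hx₀'
        linarith [dist_triangle_right x x₀ p]
    · obtain ⟨f, L, hL, hf, rfl⟩ := PC.edge_geodesic c hc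
      obtain ⟨M, hM⟩ := exists_nat_ge L
      have h0 : ∀ s ∈ Ioo 0 L, dist (f s) (f 0) = s := fun s hs => by
        have := hf.2 s (Ioo_subset_Icc_self hs) 0 ⟨le_rfl, hL.le⟩
        simpa [abs_of_pos hs.1] using this
      refine hasFiniteFibers_of_chart (f := fun x => (dist x (f 0), 0)) zero_le_one ?_ (M := M) ?_
      · rintro _ ⟨⟨s, hs, rfl⟩, -⟩ _ ⟨⟨t, ht, rfl⟩, -⟩
        simp only [h0 s hs, h0 t ht, one_mul]
        have := hf.2 s (Ioo_subset_Icc_self hs) t (Ioo_subset_Icc_self ht)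
        rw [Prod.dist_eq, dist_self, Real.dist_eq]
        exact this.le.trans (le_max_left _ _)
      · rintro _ ⟨⟨s, hs, rfl⟩, -⟩
        simp only [h0 s hs, Prod.norm_def, norm_zero, Real.norm_eq_abs, abs_of_pos hs.1]
        exact max_le (hs.2.le.trans hM) (Nat.cast_nonneg _)
  refine ((hasFiniteFibers_biUnion hfin (A := fun c => c ∩ ball p R)
    fun c hc => hcell c hc.1).union (hasFiniteFibers_of_finite hfinv)).mono fun x hx => ?_
  have hx' : x ∈ ⋃₀ PC.faces ∪ ⋃₀ PC.edges ∪ PC.vertices := PC.cover ▸ mem_univ x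
  rcases hx' with (⟨c, hc, hxc⟩ | ⟨c, hc, hxc⟩) | hv
  · exact Or.inl (mem_iUnion₂.2 ⟨c, ⟨Or.inl hc, x, hxc, hx⟩, hxc, hx⟩)
  · exact Or.inl (mem_iUnion₂.2 ⟨c, ⟨Or.inr hc, x, hxc, hx⟩, hxc, hx⟩)
  · exact Or.inr ⟨hv, hx⟩

end

open unitInterval in
/-- A circle-valued map on a space with trivial first homology has degree zero on loops. -/
theorem H1Trivial.lift_apply_one {B : Type*} [TopologicalSpace B] (hB : H1Trivial B)
    (Θ : C(B, Circle)) {x : B} (p : Path x x) (l : C(I, ℝ))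
    (h : ∀ s, Circle.exp (l s) = Θ (p s)) : l 1 = l 0 := by
  have hcov := Circle.isAddQuotientCoveringMap_exp
  have h0 : Circle.exp (l 0) = Θ x := by simpa using h 0
  set e : Circle.exp ⁻¹' {Θ x} := ⟨l 0, h0⟩ with he
  set φ := (hcov.fundamentalGroupToMulOpposite e).comp (FundamentalGroup.map Θ x)
  have h1 : φ (FundamentalGroup.fromPath (X := TopCat.of B) ⟦p⟧) = 1 := by
    have := congrArg (Abelianization.lift φ) (hB x p)
    rwa [loopClassH1, map_one, Abelianization.lift_apply_of] at this
  have h2 : hcov.isCoveringMap.monodromy (Path.Homotopic.Quotient.mk (p.map Θ.continuous)) e = e :=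
    hcov.fundamentalGroupToMulOpposite_eq_one_iff.1 h1
  have h3 : l = hcov.isCoveringMap.liftPath (p.map Θ.continuous) (l 0)
      ((p.map Θ.continuous).source.trans h0.symm) :=
    (hcov.isCoveringMap.eq_liftPath_iff' _).2 ⟨funext h, rfl⟩
  have h4 := congrArg Subtype.val h2
  exact (DFunLike.congr_fun h3 1).trans h4

/-- Some path from `x` to `y` has, under `Θ`, a lift to the real line from `α` to `β`. -/
def HasPathLift {B : Type*} [TopologicalSpace B] (Θ : C(B, Circle)) (x y : B) (α β : ℝ) : Prop :=
  ∃ (P : Path x y) (L : Path α β), ∀ s, Circle.exp (L s) = Θ (P s)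

theorem HasPathLift.trans {B : Type*} [TopologicalSpace B] {Θ : C(B, Circle)} {x y z : B}
    {α β δ : ℝ} (h : HasPathLift Θ x y α β) (h' : HasPathLift Θ y z β δ) :
    HasPathLift Θ x z α δ := by
  obtain ⟨P, L, hL⟩ := h
  obtain ⟨P', L', hL'⟩ := h'
  refine ⟨P.trans P', L.trans L', fun s => ?_⟩
  rw [Path.trans_apply, Path.trans_apply]
  split_ifs
  · exact hL _
  · exact hL' _

theorem H1Trivial.eq_of_hasPathLift {B : Type*} [TopologicalSpace B] (hB : H1Trivial B)
    {Θ : C(B, Circle)} {x : B} {α β : ℝ} (h : HasPathLift Θ x x α β) : α = β := by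
  obtain ⟨P, L, hL⟩ := h
  simpa using (hB.lift_apply_one Θ P L.toContinuousMap hL).symm

theorem hasPathLift_of_continuousOn {X : Type*} [TopologicalSpace X] {E : Set X}
    {Θ : C(E, Circle)} {f : ℝ → X} {l : ℝ → ℝ} {a b : ℝ} (hab : a ≤ b)
    (hf : ContinuousOn f (Icc a b)) (hl : ContinuousOn l (Icc a b)) (hfE : ∀ s ∈ Icc a b, f s ∈ E)
    (h : ∀ s (hs : s ∈ Icc a b), Circle.exp (l s) = Θ ⟨f s, hfE s hs⟩) :
    HasPathLift Θ ⟨f a, hfE a ⟨le_rfl, hab⟩⟩ ⟨f b, hfE b ⟨hab, le_rfl⟩⟩ (l a) (l b) := by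
  have hmem : ∀ s : unitInterval, a + s * (b - a) ∈ Icc a b := fun s =>
    ⟨by nlinarith [s.2.1], by nlinarith [s.2.2]⟩
  refine ⟨⟨⟨fun s => ⟨f (a + s * (b - a)), hfE _ (hmem s)⟩, ?_⟩, ?_, ?_⟩,
    ⟨⟨fun s => l (a + s * (b - a)), ?_⟩, ?_, ?_⟩, fun s => h _ (hmem s)⟩
  · exact Continuous.subtype_mk (hf.comp_continuous (by fun_prop) hmem) _
  · simp
  · simp
  · exact hl.comp_continuous (by fun_prop) hmem
  · simp
  · simp

open Classical in
theorem continuousOn_ite_of_isClosed {X Y : Type*} [TopologicalSpace X] [TopologicalSpace Y]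
    {S A B : Set X} (hSA : IsClosed (S ∩ A)) (hSB : IsClosed (S ∩ B)) (hAB : S ⊆ A ∪ B)
    {u v : X → Y} (hu : ContinuousOn u S) (hv : ContinuousOn v S)
    (huv : ∀ x ∈ S, x ∈ A → x ∈ B → u x = v x) :
    ContinuousOn (fun x => if x ∈ A then u x else v x) S := by
  have h1 : ContinuousOn (fun x => if x ∈ A then u x else v x) (S ∩ A) :=
    (hu.mono inter_subset_left).congr fun x hx => if_pos hx.2
  have h2 : ContinuousOn (fun x => if x ∈ A then u x else v x) (S ∩ B) :=
    (hv.mono inter_subset_left).congr fun x hx => by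
      by_cases hA : x ∈ A
      · exact (if_pos hA).trans (huv x hx.1 hA hx.2)
      · exact if_neg hA
  have h3 := h1.union_of_isClosed h2 hSA hSB
  rwa [← inter_union_distrib_left, inter_eq_self_of_subset_left hAB] at h3

/-- A loop cannot cross a two-sided closed set `Q ∩ Q'` exactly once, in the sense that it enters
`Q` through a part on which `χ = 0` and leaves it through a part on which `χ = 1`. -/
theorem H1Trivial.false_of_crossing {X : Type*} [TopologicalSpace X] {E : Set X}
    (hE : IsClosed E) (hH1 : H1Trivial E) {Q Q' : Set X} (hQ : IsClosed Q) (hQ' : IsClosed Q')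
    (hQQ : Q ∪ Q' = univ) (χ : C(X, ℝ)) (hχ : ∀ z ∈ E, z ∈ Q → z ∈ Q' → χ z = 0 ∨ χ z = 1)
    {f : ℝ → X} {a t b : ℝ} (hat : a ≤ t) (htb : t ≤ b) (hf : ContinuousOn f (Icc a b))
    (hfE : ∀ s ∈ Icc a b, f s ∈ E) (h0 : ∀ s ∈ Icc a t, f s ∈ Q → f s ∈ Q' → χ (f s) = 0)
    (h1 : ∀ s ∈ Icc t b, f s ∈ Q → f s ∈ Q' → χ (f s) = 1) (ht : f t ∉ Q')
    (hj : JoinedIn (E ∩ Qᶜ) (f b) (f a)) : False := by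
  classical
  set θ : X → Circle := fun z => if z ∈ Q then Circle.exp (2 * Real.pi * χ z) else 1 with hθ
  have hθc : ContinuousOn θ E := by
    refine continuousOn_ite_of_isClosed (hE.inter hQ) (hE.inter hQ') (by simp [hQQ])
      (by fun_prop) (by fun_prop) fun z hz hzQ hzQ' => ?_
    rcases hχ z hz hzQ hzQ' with h | h <;> rw [h]
    · simp
    · rw [mul_one, Circle.exp_two_pi]
  set Θ : C(E, Circle) := ⟨fun z => θ z, continuousOn_iff_continuous_domRestrict.1 hθc⟩ with hΘ
  have piece : ∀ c d : ℝ, c ≤ d → Icc c d ⊆ Icc a b → ∀ n : ℤ,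
      (∀ s ∈ Icc c d, f s ∈ Q → f s ∈ Q' → χ (f s) = n) → ∀ hc hd,
      HasPathLift Θ ⟨f c, hc⟩ ⟨f d, hd⟩
        (if f c ∈ Q then 2 * Real.pi * χ (f c) else 2 * Real.pi * n)
        (if f d ∈ Q then 2 * Real.pi * χ (f d) else 2 * Real.pi * n) := by
    intro c d hcd hsub n hn hc hd
    have hfc := hf.mono hsub
    refine hasPathLift_of_continuousOn (f := f)
      (l := fun s => if f s ∈ Q then 2 * Real.pi * χ (f s) else 2 * Real.pi * n) hcd hfc ?_
      (fun s hs => hfE s (hsub hs)) ?_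
    · refine continuousOn_ite_of_isClosed (A := f ⁻¹' Q) (B := f ⁻¹' Q')
        (hfc.preimage_isClosed_of_isClosed isClosed_Icc hQ)
        (hfc.preimage_isClosed_of_isClosed isClosed_Icc hQ') ?_ ?_ (by fun_prop) ?_
      · rw [← preimage_union, hQQ]
        exact fun _ _ => trivial
      · exact continuousOn_const.mul (χ.continuous.comp_continuousOn hfc)
      · intro s hs hs1 hs2
        rw [hn s hs hs1 hs2]
    · intro s hs
      simp only [hΘ, hθ, ContinuousMap.coe_mk]
      split_ifs
      · rfl
      · rw [mul_comm]; exact Circle.exp_int_mul_two_pi n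
  have htQ : f t ∈ Q := by
    have : f t ∈ Q ∪ Q' := hQQ ▸ mem_univ _
    exact this.resolve_right ht
  have haE := hj.target_mem
  have hbE := hj.source_mem
  have htE : f t ∈ E := hfE t ⟨hat, htb⟩
  have p1 := piece a t hat (Icc_subset_Icc_right htb) 0 (by exact_mod_cast h0) haE.1 htE
  have p2 := piece t b htb (Icc_subset_Icc_left hat) 1 (by exact_mod_cast h1) htE hbE.1
  rw [if_pos htQ, if_neg haE.2] at p1
  rw [if_pos htQ, if_neg hbE.2] at p2
  have p3 : HasPathLift Θ ⟨f b, hbE.1⟩ ⟨f a, haE.1⟩ (2 * Real.pi * (1 : ℤ))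
      (2 * Real.pi * (1 : ℤ)) := by
    refine ⟨⟨⟨fun s => ⟨hj.somePath s, (hj.somePath_mem s).1⟩, ?_⟩, ?_, ?_⟩, Path.refl _, ?_⟩
    · exact Continuous.subtype_mk hj.somePath.continuous _
    · simp
    · simp
    · intro s
      have := (hj.somePath_mem s).2
      change _ = θ (hj.somePath s)
      simp only [hθ, if_neg this, Path.refl_apply, Int.cast_one, mul_one, Circle.exp_two_pi]
  have := hH1.eq_of_hasPathLift ((p1.trans p2).trans p3)
  have hpi := Real.pi_pos
  simp at this

/-- A form of the inequality saying that the comparison angle at `o` of `p, o, z` has cosine at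
most `-ω`. -/
def WideAt {X : Type*} [MetricSpace X] (ω : ℝ) (o p z : X) : Prop :=
  dist o p ^ 2 + dist o z ^ 2 + 2 * ω * dist o p * dist o z ≤ dist p z ^ 2

theorem exists_continuousMap_separating {X : Type*} [TopologicalSpace X] [NormalSpace X]
    {W K₀ K₁ : Set X} (hW : IsClosed W) (hK₀ : IsCompact K₀) (hK₁ : IsCompact K₁)
    (hK₀W : K₀ ⊆ W) (hK₁W : K₁ ⊆ W)
    (h : ∀ u ∈ K₀, ∀ v ∈ K₁, ∃ N M : Set X, IsClosed N ∧ IsClosed M ∧ W ⊆ N ∪ M ∧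
      Disjoint (W ∩ N) (W ∩ M) ∧ v ∈ N ∧ u ∈ M) :
    ∃ χ : C(X, ℝ), (∀ z ∈ W, χ z = 0 ∨ χ z = 1) ∧ (∀ z ∈ K₀, χ z = 0) ∧ ∀ z ∈ K₁, χ z = 1 := by
  have hsep : ∃ N M : Set X, IsClosed N ∧ IsClosed M ∧ W ⊆ N ∪ M ∧
      Disjoint (W ∩ N) (W ∩ M) ∧ K₁ ⊆ N ∧ K₀ ⊆ M := by
    refine hK₀.induction_on (p := fun S => ∃ N M : Set X, IsClosed N ∧ IsClosed M ∧ W ⊆ N ∪ M ∧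
      Disjoint (W ∩ N) (W ∩ M) ∧ K₁ ⊆ N ∧ S ⊆ M) ?_ ?_ ?_ fun u hu => ?_
    · exact ⟨univ, ∅, isClosed_univ, isClosed_empty, by simp, by simp, by simp, by simp⟩
    · rintro S T hST ⟨N, M, h1, h2, h3, h4, h5, h6⟩
      exact ⟨N, M, h1, h2, h3, h4, h5, hST.trans h6⟩
    · rintro S T ⟨N, M, h1, h2, h3, h4, h5, h6⟩ ⟨N', M', h1', h2', h3', h4', h5', h6'⟩
      refine ⟨N ∩ N', M ∪ M', h1.inter h1', h2.union h2', ?_, ?_, subset_inter h5 h5',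
        union_subset_union h6 h6'⟩
      · intro z hz
        have := h3 hz
        have := h3' hz
        simp only [mem_union, mem_inter_iff] at *
        tauto
      · rw [Set.disjoint_left] at *
        intro z hz hz'
        simp only [mem_union, mem_inter_iff, not_and] at *
        have := @h4 z
        have := @h4' z
        tauto
    · obtain ⟨N, M, h1, h2, h3, h4, h5, h6⟩ : ∃ N M : Set X, IsClosed N ∧ IsClosed M ∧
          W ⊆ N ∪ M ∧ Disjoint (W ∩ N) (W ∩ M) ∧ K₁ ⊆ N ∧ u ∈ M := by
        refine hK₁.induction_on (p := fun T => ∃ N M : Set X, IsClosed N ∧ IsClosed M ∧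
          W ⊆ N ∪ M ∧ Disjoint (W ∩ N) (W ∩ M) ∧ T ⊆ N ∧ u ∈ M) ?_ ?_ ?_ fun v hv => ?_
        · exact ⟨∅, univ, isClosed_empty, isClosed_univ, by simp, by simp, by simp, by simp⟩
        · rintro S T hST ⟨N, M, h1, h2, h3, h4, h5, h6⟩
          exact ⟨N, M, h1, h2, h3, h4, hST.trans h5, h6⟩
        · rintro S T ⟨N, M, h1, h2, h3, h4, h5, h6⟩ ⟨N', M', h1', h2', h3', h4', h5', h6'⟩
          refine ⟨N ∪ N', M ∩ M', h1.union h1', h2.inter h2', ?_, ?_,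
            union_subset_union h5 h5', ⟨h6, h6'⟩⟩
          · intro z hz
            have := h3 hz
            have := h3' hz
            simp only [mem_union, mem_inter_iff] at *
            tauto
          · rw [Set.disjoint_left] at *
            intro z hz hz'
            simp only [mem_union, mem_inter_iff, not_and] at *
            have := @h4 z
            have := @h4' z
            tauto
        · obtain ⟨N, M, h1, h2, h3, h4, h5, h6⟩ := h u hu v hv
          refine ⟨Mᶜ ∩ K₁, inter_mem (mem_nhdsWithin_of_mem_nhds (h2.isOpen_compl.mem_nhds
            fun hvM => Set.disjoint_left.1 h4 ⟨hK₁W hv, h5⟩ ⟨hK₁W hv, hvM⟩)) self_mem_nhdsWithin,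
            N, M, h1, h2, h3, h4, fun z hz => (h3 (hK₁W hz.2)).resolve_right hz.1, h6⟩
      exact ⟨Nᶜ ∩ K₀, inter_mem (mem_nhdsWithin_of_mem_nhds (h1.isOpen_compl.mem_nhds
        fun huN => Set.disjoint_left.1 h4 ⟨hK₀W hu, huN⟩ ⟨hK₀W hu, h6⟩)) self_mem_nhdsWithin,
        N, M, h1, h2, h3, h4, h5, fun z hz => (h3 (hK₀W hz.2)).resolve_left hz.1⟩
  obtain ⟨N, M, h1, h2, h3, h4, h5, h6⟩ := hsep
  obtain ⟨χ, hχ0, hχ1, -⟩ := exists_continuous_zero_one_of_isClosed (hW.inter h2) (hW.inter h1)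
    h4.symm
  refine ⟨χ, fun z hz => ?_, fun z hz => hχ0 ⟨hK₀W hz, h6 hz⟩, fun z hz => hχ1 ⟨hK₁W hz, h5 hz⟩⟩
  rcases h3 hz with h | h
  · exact Or.inr (hχ1 ⟨hz, h⟩)
  · exact Or.inl (hχ0 ⟨hz, h⟩)

namespace IsStewartSpace

variable {X : Type*} [MetricSpace X]

theorem exists_pt_notMem (hS : IsStewartSpace X)
    {E : Set X} (hE : IsClosed E) {o x : X} (hx : x ∈ E) {ρ : ℝ}
    (hρ : 0 ≤ ρ) (hp : hS.pt o x ρ ∉ E) {P : ℝ → Prop} (hP : ∀ᵐ r, P r) :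
    ∃ r, ρ < r ∧ r < dist o x ∧ hS.pt o x r ∉ E ∧ P r := by
  have hlt : ρ < dist o x := by
    by_contra! hle
    exact hp (by rwa [hS.pt_of_dist_le hle])
  have h1 : ∀ᶠ r in nhdsWithin ρ (Ici 0), hS.pt o x r ∉ E :=
    (hS.continuousOn_pt o x ρ hρ).eventually (hE.isOpen_compl.mem_nhds hp)
  rw [eventually_nhdsWithin_iff, Metric.eventually_nhds_iff] at h1
  obtain ⟨ε, hε, h⟩ := h1
  obtain ⟨r, hr, hr'⟩ := (MeasureTheory.Measure.dense_of_ae hP).exists_between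
    (show ρ < min (ρ + ε) (dist o x) from lt_min (by linarith) hlt)
  obtain ⟨h3, h4⟩ := lt_min_iff.1 hr'.2
  refine ⟨r, hr'.1, h4, h ?_ (hρ.trans hr'.1.le), hr⟩
  rw [Real.dist_eq, abs_of_pos (by linarith [hr'.1])]
  linarith

theorem wideAt_of_dist_pt_le (hS : IsStewartSpace X)
    {o p q z : X} {r s ω : ℝ} (hpoq : Btw p o q) (hr : 0 < r)
    (hrq : r ≤ dist o q) (hrz : r ≤ dist o z) (hz : dist (hS.pt o q r) (hS.pt o z r) ≤ s)
    (hs : s ^ 2 ≤ 2 * (1 - ω) * r ^ 2) : WideAt ω o p z := by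
  set q₁ := hS.pt o q r with hq₁
  set z₁ := hS.pt o z r with hz₁
  have hb : dist q₁ z₁ ^ 2 ≤ 2 * (1 - ω) * r ^ 2 :=
    (pow_le_pow_left₀ dist_nonneg hz 2).trans hs
  have hpo : Btw q₁ o p := Btw.trans_right hpoq.symm (hS.btw_pt o q r).symm
  have hoq : dist o q₁ = r := hS.dist_pt hr.le hrq
  have hoz : dist o z₁ = r := hS.dist_pt hr.le hrz
  have i1 := hS.stewart q₁ p o z₁ hpo
  rw [← hpo, dist_comm q₁ o, hoq, dist_comm z₁ o, hoz, dist_comm z₁ q₁, dist_comm z₁ p] at i1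
  have i2 := hS.dist_pt_sq hr.le hrz p
  rw [← hz₁, dist_comm p o] at i2
  unfold WideAt
  have hP := dist_nonneg (x := o) (y := p)
  have hZ := dist_nonneg (x := o) (y := z)
  generalize dist o p = P at *
  generalize dist o z = Z at *
  generalize dist q₁ z₁ ^ 2 = B at *
  generalize dist p z₁ ^ 2 = A at *
  have h3 : r * (P ^ 2 + r ^ 2 + 2 * ω * P * r) ≤ r * A := by
    nlinarith [mul_le_mul_of_nonneg_left hb hP]
  have h4 := le_of_mul_le_mul_left h3 hr
  refine le_of_mul_le_mul_left (a := r) ?_ hr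
  nlinarith [mul_le_mul_of_nonneg_left h4 hZ]

theorem dist_pt_sq_le_of_dist_le (hS : IsStewartSpace X)
    {o q y : X} {r c : ℝ} (hr : 0 < r) (hc : -1 ≤ c)
    (hrq : r ≤ dist o q) (hry : r ≤ dist o y) (hy : dist y q ≤ dist y o - c * dist o q) :
    dist (hS.pt o q r) (hS.pt o y r) ^ 2 ≤ 2 * (1 - c) * r ^ 2 := by
  have hq : 0 < dist o q := hr.trans_le hrq
  have hc1 : c ≤ 1 := by
    have := dist_triangle y q o
    rw [dist_comm q o] at this
    nlinarith
  set q₁ := hS.pt o q r with hq₁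
  have h1 : dist y q₁ ≤ dist y o - c * r := by
    have := hS.dist_le_of_ratio (x := o) (y := q) (m := q₁) (τ := r / dist o q) (by positivity)
      ((div_le_one hq).2 hrq) (by rw [hS.dist_pt hr.le hrq]; field_simp)
      (by rw [hS.dist_pt_right hr.le hrq]; field_simp) y
    refine this.trans ?_
    have h2 : r / dist o q * dist y q ≤ r / dist o q * (dist y o - c * dist o q) := by gcongr
    have h3 : r / dist o q * dist o q = r := by field_simp
    linear_combination h2 - c * h3
  have i := hS.dist_pt_sq hr.le hry q₁
  rw [dist_comm q₁ o, hS.dist_pt hr.le hrq, dist_comm q₁ y] at i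
  have h4 : dist y q₁ ^ 2 ≤ (dist o y - c * r) ^ 2 := by
    rw [dist_comm o y]
    gcongr
  have hY : 0 < dist o y := hr.trans_le hry
  refine le_of_mul_le_mul_left (i.trans ?_) hY
  have h5 : 0 ≤ r * (r ^ 2 * ((1 - c) * (1 + c))) := by
    have : 0 ≤ 1 - c := by linarith
    have : 0 ≤ 1 + c := by linarith
    positivity
  nlinarith [mul_le_mul_of_nonneg_left h4 hr.le]

theorem two_mul_le_dist_pt (hS : IsStewartSpace X)
    {o p q : X} {r : ℝ} (hpoq : Btw p o q) (hr : 0 < r)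
    (hrq : r ≤ dist o q) (hrp : r ≤ dist o p) :
    2 * r ≤ dist (hS.pt o q r) (hS.pt o p r) := by
  have hpo : Btw (hS.pt o q r) o p := Btw.trans_right hpoq.symm (hS.btw_pt o q r).symm
  have h1 := dist_triangle (hS.pt o q r) (hS.pt o p r) p
  rw [hS.dist_pt_right hr.le hrp, ← hpo, dist_comm _ o, hS.dist_pt hr.le hrq] at h1
  linarith

/-- The part over the radii beyond `r₁` of the cone of directions at distance `s` from `q₁`. -/
theorem exists_separation_of_pt_ne (hS : IsStewartSpace X) {E : Set X} {o q₁ : X} {r₁ r s : ℝ}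
    (hr₁ : 0 ≤ r₁) (hr : r₁ < r) {W : Set X} (hWE : W ⊆ E)
    (hW : ∀ z ∈ W, r₁ < dist o z → dist q₁ (hS.pt o z r₁) = s)
    (hfin : {z | dist q₁ (hS.pt o z r₁) = s ∧ dist o z = r}.Finite)
    {x y : X} (hx : hS.pt o x r ∉ E) (hyW : y ∈ W) (hxy : hS.pt o y r ≠ hS.pt o x r) :
    ∃ N M : Set X, IsClosed N ∧ IsClosed M ∧ W ⊆ N ∪ M ∧
      Disjoint (W ∩ N) (W ∩ M) ∧ x ∈ N ∧ y ∈ M := by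
  have hr0 : 0 ≤ r := hr₁.trans hr.le
  have hc := hS.continuous_pt o hr0
  have hcover : ∀ z ∈ W, hS.pt o z r ≠ hS.pt o x r →
      z ∈ {z | dist o z ≤ r} ∪ (fun z => hS.pt o z r) ⁻¹'
        ({z | dist q₁ (hS.pt o z r₁) = s ∧ dist o z = r} \ {hS.pt o x r}) := by
    intro z hz hne
    rcases le_or_gt (dist o z) r with h | h
    · exact Or.inl h
    · refine Or.inr ⟨⟨?_, hS.dist_pt hr0 h.le⟩, hne⟩
      rw [hS.pt_pt hr₁ hr.le]
      exact hW z hz (hr.trans h)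
  refine ⟨(fun z => hS.pt o z r) ⁻¹' {hS.pt o x r}, _,
    isClosed_singleton.preimage hc, (isClosed_le (by fun_prop) continuous_const).union
      ((hfin.subset sdiff_subset).isClosed.preimage hc), fun z hz => ?_, ?_, rfl,
    hcover y hyW hxy⟩
  · by_cases h : hS.pt o z r = hS.pt o x r
    · exact Or.inl h
    · exact Or.inr (hcover z hz h)
  · rw [Set.disjoint_left]
    rintro z ⟨hzW, hzN : hS.pt o z r = hS.pt o x r⟩ ⟨-, hzM | hzM⟩
    · rw [hS.pt_of_dist_le hzM] at hzN
      exact hx (hzN ▸ hWE hzW)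
    · exact hzM.2 hzN

theorem exists_last_common_pt (hS : IsStewartSpace X)
    (o u v : X) : ∃ μ, 0 ≤ μ ∧ μ ≤ dist o u ∧ μ ≤ dist o v ∧
    hS.pt o u μ = hS.pt o v μ ∧ (∀ r, μ < r → r ≤ dist o u → hS.pt o u r ≠ hS.pt o v r) ∧
    ∀ r, μ < r → r ≤ dist o v → hS.pt o u r ≠ hS.pt o v r := by
  have hc : IsCompact {r ∈ Icc 0 (min (dist o u) (dist o v)) | hS.pt o u r = hS.pt o v r} := by
    refine isCompact_Icc.of_isClosed_subset ?_ (sep_subset _ _)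
    have hsub : Icc 0 (min (dist o u) (dist o v)) ⊆ Ici 0 := Icc_subset_Ici_self
    have h := ((hS.continuousOn_pt o u).mono hsub).prodMk ((hS.continuousOn_pt o v).mono hsub)
    exact h.preimage_isClosed_of_isClosed isClosed_Icc isClosed_diagonal
  obtain ⟨μ, ⟨⟨h0, h1⟩, h2⟩, hμ⟩ := hc.exists_isGreatest
    ⟨0, ⟨le_rfl, le_min dist_nonneg dist_nonneg⟩, by rw [hS.pt_zero, hS.pt_zero]⟩
  obtain ⟨h3, h4⟩ := le_min_iff.1 h1
  have key : ∀ r, μ < r → r ≤ dist o u → r ≤ dist o v → hS.pt o u r ≠ hS.pt o v r :=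
    fun r hr hu hv h => hr.not_ge (hμ ⟨⟨h0.trans hr.le, le_min hu hv⟩, h⟩)
  have key2 : ∀ a b : X, ∀ r, 0 ≤ r → r ≤ dist o a → hS.pt o a r = hS.pt o b r →
      r ≤ dist o b := by
    intro a b r hr ha h
    rw [← hS.dist_pt hr ha, h]
    exact hS.dist_pt_le_dist
  exact ⟨μ, h0, h3, h4, h2, fun r hr hu h => key r hr hu (key2 u v r (h0.trans hr.le) hu h) h,
    fun r hr hv h => key r hr (key2 v u r (h0.trans hr.le) hv h.symm) hv h⟩

theorem exists_pos_radius (hS : IsStewartSpace X)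
    {E : Set X} (hE : IsClosed E) {o p : X} {ω t b : ℝ} {f : ℝ → X}
    (hf : ContinuousOn f (Icc t b)) (hfE : ∀ s ∈ Icc t b, f s ∈ E)
    (hR : ∀ s ∈ Icc t b, WideAt ω o p (f s) → ∃ n, Btw o n (f s) ∧ n ∉ E) :
    ∃ r > 0, (∀ s ∈ Icc t b, r ≤ dist o (f s)) ∧
      ∀ s ∈ Icc t b, WideAt ω o p (f s) → ∃ ρ, r < ρ ∧ hS.pt o (f s) ρ ∉ E := by
  have hK : IsCompact {s ∈ Icc t b | WideAt ω o p (f s)} := by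
    refine isCompact_Icc.of_isClosed_subset ?_ (sep_subset _ _)
    have hcl : IsClosed {z | WideAt ω o p z} := isClosed_le (by fun_prop) (by fun_prop)
    exact hf.preimage_isClosed_of_isClosed isClosed_Icc hcl
  have h1 : ∃ r > 0, ∀ s ∈ {s ∈ Icc t b | WideAt ω o p (f s)},
      ∃ ρ, r < ρ ∧ hS.pt o (f s) ρ ∉ E := by
    refine hK.induction_on (p := fun S => ∃ r > 0, ∀ s ∈ S, ∃ ρ, r < ρ ∧ hS.pt o (f s) ρ ∉ E)
      ⟨1, one_pos, by simp⟩ ?_ ?_ ?_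
    · rintro S T hST ⟨r, hr, h⟩
      exact ⟨r, hr, fun s hs => h s (hST hs)⟩
    · rintro S T ⟨r, hr, h⟩ ⟨r', hr', h'⟩
      refine ⟨min r r', lt_min hr hr', ?_⟩
      rintro s (hs | hs)
      · obtain ⟨ρ, h1, h2⟩ := h s hs
        exact ⟨ρ, (min_le_left _ _).trans_lt h1, h2⟩
      · obtain ⟨ρ, h1, h2⟩ := h' s hs
        exact ⟨ρ, (min_le_right _ _).trans_lt h1, h2⟩
    · rintro s ⟨hs, hsw⟩
      obtain ⟨n, hn, hnE⟩ := hR s hs hsw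
      rw [← hS.eq_pt hn] at hnE
      obtain ⟨r, hr, -, hrE, -⟩ := hS.exists_pt_notMem hE (hfE s hs) dist_nonneg hnE
        (P := fun _ => True) (by simp)
      have hr0 : 0 < r := dist_nonneg.trans_lt hr
      have hev : ∀ᶠ s' in nhdsWithin s (Icc t b), hS.pt o (f s') r ∉ E :=
        (((hS.continuous_pt o hr0.le).comp_continuousOn hf) s hs).eventually
          (hE.isOpen_compl.mem_nhds hrE)
      exact ⟨_, nhdsWithin_mono _ (sep_subset _ _) hev, r / 2, by positivity,
        fun s' hs' => ⟨r, by linarith, hs'⟩⟩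
  obtain ⟨r, hr, h⟩ := h1
  rcases (Icc t b).eq_empty_or_nonempty with he | hne
  · exact ⟨r, hr, by simp [he], fun s hs hw => h s ⟨hs, hw⟩⟩
  obtain ⟨s₀, hs₀, hmin⟩ := isCompact_Icc.exists_isMinOn hne
    (show ContinuousOn (fun s => dist o (f s)) (Icc t b) by fun_prop)
  have hpos : 0 < dist o (f s₀) := by
    rw [dist_pos]
    intro ho
    obtain ⟨n, hn, hnE⟩ := hR s₀ hs₀ (by rw [← ho]; simp [WideAt, dist_comm])
    rw [← ho, Btw, dist_self, dist_comm n o] at hn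
    have : o = n := dist_eq_zero.1 (by linarith)
    exact hnE (by rw [← this, ho]; exact hfE s₀ hs₀)
  refine ⟨min r (dist o (f s₀)), lt_min hr hpos, fun s hs => (min_le_right _ _).trans (hmin hs),
    fun s hs hw => ?_⟩
  obtain ⟨ρ, h1, h2⟩ := h s ⟨hs, hw⟩
  exact ⟨ρ, (min_le_left _ _).trans_lt h1, h2⟩

theorem false_of_no_bridge (hS : IsStewartSpace X) {E : Set X} (hE : IsClosed E) (hH1 : H1Trivial E)
    {f : ℝ → X} {a t b : ℝ} (hat : a ≤ t) (htb : t ≤ b) (hf : ContinuousOn f (Icc a b))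
    (hfE : ∀ s ∈ Icc a b, f s ∈ E) {o q : X} (hpoq : Btw (f t) o q) (hpo : 0 < dist (f t) o)
    (hoq : 0 < dist o q) {c ω : ℝ} (hc : -1 ≤ c) (hω : -1 < ω) (hωc : ω < c)
    (hj : JoinedIn (E ∩ {y | dist y q ≤ dist y o - c * dist o q}) (f b) (f a))
    {ρ : ℝ} (hρ : HasFiniteFibers (closedBall o ρ)) (hfρ : ∀ s ∈ Icc a b, f s ∈ closedBall o ρ)
    (hno : ∀ s₁ ∈ Icc a t, ∀ s₂ ∈ Icc t b, ∀ m, WideAt ω o (f t) (f s₁) →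
      WideAt ω o (f t) (f s₂) → Btw o m (f s₁) → Btw o m (f s₂) →
      (∃ n, Btw m n (f s₁) ∧ n ∉ E) ∨ ∃ n, Btw m n (f s₂) ∧ n ∉ E)
    (hR : ∀ s ∈ Icc t b, WideAt ω o (f t) (f s) → ∃ n, Btw o n (f s) ∧ n ∉ E) : False := by
  have hsub0 : Icc a t ⊆ Icc a b := Icc_subset_Icc_right htb
  have hsub1 : Icc t b ⊆ Icc a b := Icc_subset_Icc_left hat
  obtain ⟨r₀, hr₀, hdist, hgap⟩ := hS.exists_pos_radius hE (hf.mono hsub1)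
    (fun s hs => hfE s (hsub1 hs)) hR
  rw [dist_comm] at hpo
  obtain ⟨r₁, hr₁, hr₁lt⟩ := exists_between (lt_min hr₀ (lt_min hpo hoq))
  simp only [lt_min_iff] at hr₁lt
  obtain ⟨hr₁₀, hr₁p, hr₁q⟩ := hr₁lt
  set q₁ := hS.pt o q r₁ with hq₁
  set β : X → ℝ := fun z => dist q₁ (hS.pt o z r₁) with hβ
  have hβc : Continuous β := continuous_const.dist (hS.continuous_pt o hr₁.le)
  have hgL : LipschitzWith 1 (fun z => (β z, dist o z)) := by
    have h := (((LipschitzWith.dist_right q₁).comp (hS.lipschitzWith_pt o hr₁.le)).prodMk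
      (LipschitzWith.dist_right o))
    simpa using h
  have hae := hρ 1 _ hgL
  rw [MeasureTheory.Measure.volume_eq_prod] at hae
  have hae2 := MeasureTheory.Measure.ae_ae_of_ae_prod hae
  have hc1 : 0 ≤ 2 * (1 - c) := by
    by_contra! hc1
    obtain ⟨-, h2 : dist (f b) q ≤ _⟩ := hj.source_mem
    have := dist_triangle (f b) q o
    rw [dist_comm q o] at this
    nlinarith
  have hω1 : 0 ≤ 2 * (1 - ω) := by linarith
  have hsq : √(2 * (1 - c)) * r₁ < √(2 * (1 - ω)) * r₁ :=
    mul_lt_mul_of_pos_right (Real.sqrt_lt_sqrt hc1 (by linarith)) hr₁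
  obtain ⟨s, hs, hsl, hsr⟩ := (MeasureTheory.Measure.dense_of_ae hae2).exists_between hsq
  change ∀ᵐ r, _ at hs
  have hs0 : 0 ≤ s := le_trans (by positivity) hsl.le
  have hsω : s ^ 2 ≤ 2 * (1 - ω) * r₁ ^ 2 := by
    rw [← Real.sq_sqrt hω1, ← mul_pow]
    exact pow_le_pow_left₀ hs0 hsr.le 2
  have hsc : 2 * (1 - c) * r₁ ^ 2 < s ^ 2 := by
    rw [← Real.sq_sqrt hc1, ← mul_pow]
    exact pow_lt_pow_left₀ hsl (by positivity) two_ne_zero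
  have hs2 : s < 2 * r₁ := by
    refine lt_of_pow_lt_pow_left₀ 2 (by positivity) (hsω.trans_lt ?_)
    nlinarith [pow_pos hr₁ 2]
  set Q : Set X := {z | r₁ ≤ dist o z} ∩ {z | s ≤ β z} with hQ
  set Q' : Set X := {z | dist o z ≤ r₁} ∪ {z | β z ≤ s} with hQ'
  have hQc : IsClosed Q := (isClosed_le (by fun_prop) (by fun_prop)).inter
    (isClosed_le (by fun_prop) (by fun_prop))
  have hQ'c : IsClosed Q' := (isClosed_le (by fun_prop) (by fun_prop)).union
    (isClosed_le (by fun_prop) (by fun_prop))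
  set W : Set X := E ∩ (Q ∩ Q') with hWdef
  have hWc : IsClosed W := hE.inter (hQc.inter hQ'c)
  have hWs : ∀ z ∈ W, r₁ < dist o z → β z = s := by
    rintro z ⟨-, ⟨-, h1⟩, h2 | h2⟩ hz
    · exact absurd hz (not_lt.2 h2)
    · exact le_antisymm h2 h1
  have hwide : ∀ z, r₁ ≤ dist o z → β z = s → WideAt ω o (f t) z := fun z hz hzs =>
    hS.wideAt_of_dist_pt_le hpoq hr₁ hr₁q.le hz hzs.le hsω
  have hcompact : ∀ c d, Icc c d ⊆ Icc a b → IsCompact (f '' {x ∈ Icc c d | f x ∈ W}) := by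
    intro c d hcd
    refine IsCompact.image_of_continuousOn (isCompact_Icc.of_isClosed_subset ?_ (sep_subset _ _))
      (hf.mono ((sep_subset _ _).trans hcd))
    exact (hf.mono hcd).preimage_isClosed_of_isClosed isClosed_Icc hWc
  have hsepar : ∀ x y, x ∈ W → y ∈ W → x ∈ closedBall o ρ → ∀ r, r₁ < r → r < dist o x →
      hS.pt o x r ∉ E → (closedBall o ρ ∩ (fun z => (β z, dist o z)) ⁻¹' {(s, r)}).Finite →
      hS.pt o y r ≠ hS.pt o x r → ∃ N M : Set X, IsClosed N ∧ IsClosed M ∧ W ⊆ N ∪ M ∧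
      Disjoint (W ∩ N) (W ∩ M) ∧ x ∈ N ∧ y ∈ M := by
    intro x y hxW hyW hxρ r hr hrx hxE hfin hne
    refine hS.exists_separation_of_pt_ne hr₁.le hr inter_subset_left hWs (hfin.subset ?_)
      hxE hyW hne
    rintro z ⟨h1, h2⟩
    rw [mem_closedBall, dist_comm] at hxρ
    refine ⟨?_, by simp [hβ, h1, h2]⟩
    rw [mem_closedBall, dist_comm, h2]
    linarith
  have hpair : ∀ u ∈ f '' {x ∈ Icc a t | f x ∈ W}, ∀ v ∈ f '' {x ∈ Icc t b | f x ∈ W},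
      ∃ N M : Set X, IsClosed N ∧ IsClosed M ∧ W ⊆ N ∪ M ∧
        Disjoint (W ∩ N) (W ∩ M) ∧ v ∈ N ∧ u ∈ M := by
    rintro _ ⟨s₁, ⟨hs₁, hu⟩, rfl⟩ _ ⟨s₂, ⟨hs₂, hv⟩, rfl⟩
    obtain ⟨μ, hμ0, hμu, hμv, hμ, hμu', hμv'⟩ := hS.exists_last_common_pt o (f s₁) (f s₂)
    have hvr : r₁ < dist o (f s₂) := hr₁₀.trans_le (hdist s₂ hs₂)
    have hvw := hwide _ hvr.le (hWs _ hv hvr)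
    have hv_gap : ∀ ρ', r₁ ≤ ρ' → μ ≤ ρ' → hS.pt o (f s₂) ρ' ∉ E →
        ∃ N M : Set X, IsClosed N ∧ IsClosed M ∧ W ⊆ N ∪ M ∧
        Disjoint (W ∩ N) (W ∩ M) ∧ f s₂ ∈ N ∧ f s₁ ∈ M := by
      intro ρ' h1 h2 h3
      obtain ⟨r, hr, hr', hrE, hfin⟩ := hS.exists_pt_notMem hE hv.1 (hr₁.le.trans h1) h3 hs
      exact hsepar _ _ hv hu (hfρ _ (hsub1 hs₂)) r (h1.trans_lt hr) hr' hrE hfin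
        (hμv' r (h2.trans_lt hr) hr'.le)
    rcases le_or_gt μ r₁ with hle | hlt
    · obtain ⟨ρ', h1, h2⟩ := hgap s₂ hs₂ hvw
      exact hv_gap ρ' (hr₁₀.le.trans h1.le) (hle.trans (hr₁₀.le.trans h1.le)) h2
    · have hur : r₁ < dist o (f s₁) := hlt.trans_le hμu
      have huw := hwide _ hur.le (hWs _ hu hur)
      have hfar : ∀ z n, μ ≤ dist o z → Btw (hS.pt o z μ) n z →
          μ ≤ dist o n ∧ hS.pt o z (dist o n) = n := by
        intro z n hz hn
        have h1 := (hS.btw_pt o z μ).symm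
        have h2 := h1.trans_right hn.symm
        have h3 := (h1.trans hn.symm).symm
        refine ⟨?_, hS.eq_pt h3⟩
        rw [Btw, dist_comm _ o, hS.dist_pt hμ0 hz, dist_comm n o] at h2
        linarith [dist_nonneg (x := n) (y := hS.pt o z μ)]
      rcases hno s₁ hs₁ s₂ hs₂ (hS.pt o (f s₁) μ) huw hvw (hS.btw_pt _ _ _)
        (hμ ▸ hS.btw_pt _ _ _) with ⟨n, hn, hnE⟩ | ⟨n, hn, hnE⟩
      · obtain ⟨h1, h2⟩ := hfar _ _ hμu hn
        rw [← h2] at hnE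
        obtain ⟨r, hr, hr', hrE, hfin⟩ := hS.exists_pt_notMem hE hu.1 (hμ0.trans h1) hnE hs
        obtain ⟨N, M, hN, hM, hNM, hd, h3, h4⟩ := hsepar _ _ hu hv (hfρ _ (hsub0 hs₁)) r
          ((hlt.trans_le h1).trans hr) hr' hrE hfin (hμu' r (h1.trans_lt hr) hr'.le).symm
        exact ⟨M, N, hM, hN, by rwa [union_comm], hd.symm, h4, h3⟩
      · rw [hμ] at hn
        obtain ⟨h1, h2⟩ := hfar _ _ hμv hn
        rw [← h2] at hnE
        exact hv_gap _ (hlt.le.trans h1) h1 hnE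
  obtain ⟨χ, hχ, hχ0, hχ1⟩ := exists_continuousMap_separating hWc (hcompact a t hsub0)
    (hcompact t b hsub1) (by rintro _ ⟨x, hx, rfl⟩; exact hx.2)
    (by rintro _ ⟨x, hx, rfl⟩; exact hx.2) hpair
  refine H1Trivial.false_of_crossing hE hH1 hQc hQ'c ?_ χ
    (fun z hz hzQ hzQ' => hχ z ⟨hz, hzQ, hzQ'⟩) hat htb hf hfE
    (fun x hx hxQ hxQ' => hχ0 _ ⟨x, ⟨hx, hfE x (hsub0 hx), hxQ, hxQ'⟩, rfl⟩)
    (fun x hx hxQ hxQ' => hχ1 _ ⟨x, ⟨hx, hfE x (hsub1 hx), hxQ, hxQ'⟩, rfl⟩) ?_ (hj.mono ?_)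
  · refine eq_univ_of_forall fun z => ?_
    rcases le_total (dist o z) r₁ with h | h
    · exact Or.inr (Or.inl h)
    · rcases le_total (β z) s with h' | h'
      · exact Or.inr (Or.inr h')
      · exact Or.inl ⟨h, h'⟩
  · have h2 := hS.two_mul_le_dist_pt hpoq hr₁ hr₁q.le hr₁p.le
    rintro (h | h)
    · exact hr₁p.not_ge h
    · exact absurd (h2.trans h) (not_le.2 hs2)
  · rintro y ⟨hyE, hy⟩
    refine ⟨hyE, fun hyQ => ?_⟩
    have h1 := hS.dist_pt_sq_le_of_dist_le hr₁ hc hr₁q.le hyQ.1 hy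
    have h2 : s ^ 2 ≤ β y ^ 2 := pow_le_pow_left₀ hs0 hyQ.2 2
    exact absurd (h2.trans h1) (not_le.2 hsc)

/-- The wall lemma: if a path `f` in `E` is closed up inside a region seen from `o` in directions
close to `q`, then `f` has two points before and after `f t`, wide at `o`, joined in `E` by the
tripod spanned by them and `o`. -/
theorem exists_bridge (hS : IsStewartSpace X) {E : Set X} (hE : IsClosed E) (hH1 : H1Trivial E)
    {f : ℝ → X} {a t b : ℝ} (hat : a ≤ t) (htb : t ≤ b) (hf : ContinuousOn f (Icc a b))
    (hfE : ∀ s ∈ Icc a b, f s ∈ E) {o q : X} (hpoq : Btw (f t) o q) (hpo : 0 < dist (f t) o)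
    (hoq : 0 < dist o q) {c ω : ℝ} (hc : -1 ≤ c) (hω : -1 < ω) (hωc : ω < c)
    (hj : JoinedIn (E ∩ {y | dist y q ≤ dist y o - c * dist o q}) (f b) (f a))
    {ρ : ℝ} (hρ : HasFiniteFibers (closedBall o ρ)) (hfρ : ∀ s ∈ Icc a b, f s ∈ closedBall o ρ) :
    ∃ s₁ ∈ Icc a t, ∃ s₂ ∈ Icc t b, ∃ m, WideAt ω o (f t) (f s₁) ∧
      WideAt ω o (f t) (f s₂) ∧ Btw o m (f s₁) ∧ Btw o m (f s₂) ∧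
      (∀ n, Btw m n (f s₁) → n ∈ E) ∧ ∀ n, Btw m n (f s₂) → n ∈ E := by
  by_contra! hno
  have hno' : ∀ s₁ ∈ Icc a t, ∀ s₂ ∈ Icc t b, ∀ m, WideAt ω o (f t) (f s₁) →
      WideAt ω o (f t) (f s₂) → Btw o m (f s₁) → Btw o m (f s₂) →
      (∃ n, Btw m n (f s₁) ∧ n ∉ E) ∨ ∃ n, Btw m n (f s₂) ∧ n ∉ E := by
    intro s₁ hs₁ s₂ hs₂ m h1 h2 h3 h4
    by_contra! h
    obtain ⟨n, hn, hn'⟩ := hno s₁ hs₁ s₂ hs₂ m h1 h2 h3 h4 h.1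
    exact hn' (h.2 n hn)
  by_cases hR : ∀ s ∈ Icc t b, WideAt ω o (f t) (f s) → ∃ n, Btw o n (f s) ∧ n ∉ E
  · exact hS.false_of_no_bridge hE hH1 hat htb hf hfE hpoq hpo hoq hc hω hωc hj hρ hfρ hno' hR
  push Not at hR
  obtain ⟨s₂, hs₂, hw₂, hE₂⟩ := hR
  have hneg : ∀ x y s : ℝ, s ∈ Icc (-y) (-x) → -s ∈ Icc x y := fun x y s hs =>
    ⟨by linarith [hs.2], by linarith [hs.1]⟩
  refine hS.false_of_no_bridge hE hH1 (f := fun s => f (-s)) (a := -b) (t := -t) (b := -a)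
    (by linarith) (by linarith) (hf.comp (by fun_prop) (hneg a b))
    (fun s hs => hfE _ (hneg a b s hs)) (c := c) (ω := ω) (q := q) (o := o) (ρ := ρ)
    ?_ ?_ hoq hc hω hωc ?_ hρ (fun s hs => hfρ _ (hneg a b s hs)) ?_ ?_ <;>
    simp only [neg_neg]
  · exact hpoq
  · exact hpo
  · exact hj.symm
  · intro s₁ hs₁ s₂ hs₂ m h1 h2 h3 h4
    exact (hno' _ (hneg a t _ hs₂) _ (hneg t b _ hs₁) m h2 h1 h4 h3).symm
  · intro s hs hw
    rcases hno' _ (hneg a t _ hs) s₂ hs₂ o hw hw₂ (by simp [Btw]) (by simp [Btw]) with h | h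
    · exact h
    · obtain ⟨n, hn, hn'⟩ := h
      exact absurd (hE₂ n hn) hn'

end IsStewartSpace

theorem WideAt.ne {X : Type*} [MetricSpace X] {ω : ℝ} (hω : -1 < ω) {o p z : X}
    (hp : 0 < dist p o) (h : WideAt ω o p z) : z ≠ p := by
  rintro rfl
  rw [WideAt, dist_self, dist_comm o z] at h
  nlinarith [mul_pos hp hp]

theorem WideAt.dist_lt {X : Type*} [MetricSpace X] {o p z : X}
    (hp : 0 < dist p o) (h : WideAt 0 o p z) : dist o z < dist p z := by
  rw [WideAt, dist_comm o p] at h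
  refine lt_of_pow_lt_pow_left₀ 2 dist_nonneg ?_
  nlinarith [mul_pos hp hp]

namespace IsStewartSpace

variable {X : Type*} [MetricSpace X]

theorem exists_almost_projection (hS : IsStewartSpace X)
    {A : Set X} (hA : ∀ x ∈ A, ∀ y ∈ A, ∀ m, Btw x m y → m ∈ A)
    (hne : A.Nonempty) {p : X} (hp : 0 < infDist p A) {M : ℝ} (hM : 0 < M) :
    ∃ o ∈ A, ∃ δ > 0, ∀ y ∈ A, dist p y ≤ M → dist y o + δ ≤ dist p y := by
  set d := infDist p A with hd
  set τ : ℝ := min (1 / 2) (d ^ 2 / (4 * (d + 1 + M) ^ 2)) with hτ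
  have hτ0 : 0 < τ := lt_min (by norm_num) (by positivity)
  have hτ1 : τ ≤ 1 := (min_le_left _ _).trans (by norm_num)
  have hτM : τ * (d + 1 + M) ^ 2 ≤ d ^ 2 / 4 := by
    have h := min_le_right (1 / 2) (d ^ 2 / (4 * (d + 1 + M) ^ 2))
    rw [← hτ, le_div_iff₀ (by positivity)] at h
    linarith
  obtain ⟨e, he, hed⟩ : ∃ e, d < e ∧ e ≤ d + 1 ∧ e ^ 2 ≤ d ^ 2 + τ * d ^ 2 / 4 := by
    have h1 : 0 < τ * d ^ 2 / 4 := by positivity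
    refine ⟨min (d + 1) √(d ^ 2 + τ * d ^ 2 / 4), lt_min (by linarith)
      (Real.lt_sqrt_of_sq_lt (by linarith)), min_le_left _ _, ?_⟩
    refine (pow_le_pow_left₀ (le_min (by linarith) (Real.sqrt_nonneg _)) (min_le_right _ _) 2).trans
      (Real.sq_sqrt (by positivity)).le
  obtain ⟨o, ho, hpo⟩ := (infDist_lt_iff hne).1 he
  refine ⟨o, ho, d ^ 2 / 2 / (2 * M), by positivity, fun y hy hyM => ?_⟩
  obtain ⟨n, hn1, hn2⟩ := hS.exists_ratio o y hτ0.le hτ1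
  have hn : n ∈ A := hA o ho y hy n (by rw [Btw, hn1, hn2]; ring)
  have h1 : d ^ 2 ≤ dist p n ^ 2 := pow_le_pow_left₀ hp.le (infDist_le_dist_of_mem hn) 2
  have h2 := h1.trans (hS.stewart_ratio hn1 hn2 p)
  have h3 : dist p o ^ 2 ≤ d ^ 2 + τ * d ^ 2 / 4 :=
    (pow_le_pow_left₀ dist_nonneg hpo.le 2).trans hed.2
  have h4 : dist o y ≤ d + 1 + M := by
    have := dist_triangle_left o y p
    linarith
  have h5 : τ * dist o y ^ 2 ≤ d ^ 2 / 4 := le_trans (by gcongr) hτM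
  have h6 : dist o y ^ 2 + d ^ 2 / 2 ≤ dist p y ^ 2 := by
    refine le_of_mul_le_mul_left (a := τ) ?_ hτ0
    nlinarith [mul_le_mul_of_nonneg_left h3 (sub_nonneg.2 hτ1),
      mul_le_mul_of_nonneg_left h5 hτ0.le, mul_nonneg hτ0.le (mul_nonneg hτ0.le (sq_nonneg d))]
  have h7 : dist o y ≤ dist p y := by
    refine le_of_sq_le_sq ?_ dist_nonneg
    nlinarith [sq_nonneg d]
  rw [dist_comm y o]
  have h8 : d ^ 2 / 2 / (2 * M) ≤ dist p y - dist o y := by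
    rw [div_le_iff₀ (by positivity)]
    nlinarith [dist_nonneg (x := o) (y := y), sub_nonneg.2 h7]
  linarith

/-- Points of small positive distance from `p` on the geodesic from `p` to `q`. -/
theorem exists_btw_near (hS : IsStewartSpace X)
    {p q : X} (hpq : 0 < dist p q) {ε : ℝ} (hε : 0 < ε) :
    ∃ o, Btw p o q ∧ 0 < dist p o ∧ dist p o ≤ ε ∧ 0 < dist o q := by
  have hx : 0 < min ε (dist p q / 2) := lt_min hε (by positivity)
  have hx1 : min ε (dist p q / 2) ≤ dist p q / 2 := min_le_right _ _
  have hx2 : min ε (dist p q / 2) ≤ dist p q := by linarith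
  refine ⟨hS.pt p q (min ε (dist p q / 2)), hS.btw_pt _ _ _, ?_, ?_, ?_⟩
  · rwa [hS.dist_pt hx.le hx2]
  · rw [hS.dist_pt hx.le hx2]
    exact min_le_left _ _
  · rw [hS.dist_pt_right hx.le hx2]
    linarith

/-- A first bridge: two points of `f` on both sides of the maximum `f t` are joined inside `E` by
two geodesics through a point strictly closer to `C`. -/
theorem exists_bridge_of_isMax (hS : IsStewartSpace X)
    {E C : Set X} (hE : IsClosed E) (hH1 : H1Trivial E)
    (hC : ∀ x ∈ C, ∀ y ∈ C, ∀ m, Btw x m y → m ∈ C) (hCne : C.Nonempty)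
    {f : ℝ → X} {a t b R : ℝ} (hat : a < t) (htb : t < b) (hf : ContinuousOn f (Icc a b))
    (hfE : ∀ s ∈ Icc a b, f s ∈ E) (hR : 0 < R) (hfin : HasFiniteFibers (ball (f t) R))
    (hfR : ∀ s ∈ Icc a b, dist (f s) (f t) ≤ R / 3)
    (hlt : ∀ s ∈ Ico a t, infDist (f s) C < infDist (f t) C)
    (hj : JoinedIn (E ∩ {y | infDist y C ≤ infDist (f t) C ∧ y ≠ f t}) (f b) (f a)) :
    ∃ s₁ ∈ Ico a t, ∃ s₂ ∈ Icc t b, ∃ m, f s₂ ≠ f t ∧ infDist m C < infDist (f t) C ∧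
      (∀ n, Btw m n (f s₁) → n ∈ E) ∧ ∀ n, Btw m n (f s₂) → n ∈ E := by
  obtain ⟨q, hq⟩ := hCne
  have hD : 0 < infDist (f t) C := infDist_nonneg.trans_lt (hlt a ⟨le_rfl, hat⟩)
  have hpq : 0 < dist (f t) q := hD.trans_le (infDist_le_dist_of_mem hq)
  obtain ⟨δ, hδ, hδj⟩ : ∃ δ > 0,
      JoinedIn (E ∩ {y | dist y q + δ ≤ dist (f t) q + dist y (f t)}) (f b) (f a) := by
    obtain ⟨γ, hγ⟩ := hj
    obtain ⟨x, -, hx⟩ := isCompact_univ.exists_isMinOn univ_nonempty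
      (show ContinuousOn (fun x => dist (f t) q + dist (γ x) (f t) - dist (γ x) q) univ by
        fun_prop)
    refine ⟨dist (f t) q + dist (γ x) (f t) - dist (γ x) q, ?_, γ, fun x' => ⟨(hγ x').1, ?_⟩⟩
    · obtain ⟨-, h1, h2⟩ := hγ x
      have htri := dist_triangle (γ x) (f t) q
      by_contra! hle
      have hb : Btw q (f t) (γ x) := by
        rw [Btw, dist_comm q, dist_comm q, dist_comm (f t) (γ x)]
        linarith
      obtain ⟨τ, h3, h4, h5, h6⟩ := hb.exists_ratio
      have h7 := hS.infDist_le_of_ratio hC ⟨q, hq⟩ h3 h4 h5 h6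
      rw [infDist_zero_of_mem hq, mul_zero, zero_add] at h7
      have h8 : 1 ≤ τ := by
        by_contra! h8
        nlinarith
      have h9 : dist (f t) (γ x) ≤ 0 := by
        rw [h6]
        exact mul_nonpos_of_nonpos_of_nonneg (by linarith) dist_nonneg
      exact h2 (dist_le_zero.1 h9).symm
    · have := isMinOn_iff.1 hx x' (mem_univ x')
      change dist (γ x') q + _ ≤ _
      linarith
  obtain ⟨o, hpoq, hpo, hoε, hoq⟩ := hS.exists_btw_near hpq
    (show 0 < min (δ / 4) (R / 4) by positivity)
  have hoδ := hoε.trans (min_le_left _ _)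
  have hoR := hoε.trans (min_le_right _ _)
  have hδq : 0 < δ / (2 * dist o q) := by positivity
  have hj' : JoinedIn (E ∩ {y | dist y q ≤ dist y o - (-1 + δ / (2 * dist o q)) * dist o q})
      (f b) (f a) := by
    refine hδj.mono ?_
    rintro y ⟨hyE, hy⟩
    refine ⟨hyE, ?_⟩
    have h1 : δ / (2 * dist o q) * dist o q = δ / 2 := by field_simp
    have h2 := dist_triangle y o (f t)
    rw [dist_comm o (f t)] at h2
    unfold Btw at hpoq
    change dist y q + δ ≤ _ at hy
    change dist y q ≤ _
    linarith
  have hball : closedBall o (2 * R / 3) ⊆ ball (f t) R := by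
    intro y hy
    rw [mem_closedBall] at hy
    rw [mem_ball]
    have h2 := dist_triangle y o (f t)
    rw [dist_comm o (f t)] at h2
    linarith
  have hfo : ∀ s ∈ Icc a b, f s ∈ closedBall o (2 * R / 3) := by
    intro s hs
    rw [mem_closedBall]
    have h2 := dist_triangle (f s) (f t) o
    have := hfR s hs
    linarith
  set ω : ℝ := -1 + δ / (2 * dist o q) / 2 with hω
  obtain ⟨s₁, hs₁, s₂, hs₂, m, hw₁, hw₂, hm₁, hm₂, hE₁, hE₂⟩ :=
    hS.exists_bridge hE hH1 hat.le htb.le hf hfE hpoq hpo hoq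
      (c := -1 + δ / (2 * dist o q)) (ω := ω) (by linarith) (by linarith) (by linarith)
      hj' (hfin.mono hball) hfo
  have h1 : s₁ ≠ t := fun h => hw₁.ne (by linarith) hpo (by rw [h])
  have hs₁' : s₁ ∈ Ico a t := ⟨hs₁.1, lt_of_le_of_ne hs₁.2 h1⟩
  refine ⟨s₁, hs₁', s₂, hs₂, m, hw₂.ne (by linarith) hpo, ?_, hE₁, hE₂⟩
  have ho : infDist o C < infDist (f t) C := by
    obtain ⟨τ, h3, h4, h5, h6⟩ := hpoq.exists_ratio
    have h7 := hS.infDist_le_of_ratio hC ⟨q, hq⟩ h3 h4 h5 h6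
    rw [infDist_zero_of_mem hq, mul_zero, add_zero] at h7
    have : 0 < τ := by
      by_contra! h
      nlinarith
    nlinarith
  obtain ⟨τ, h3, h4, h5, h6⟩ := hm₁.exists_ratio
  have h7 := hS.infDist_le_of_ratio hC ⟨q, hq⟩ h3 h4 h5 h6
  have h8 := hlt s₁ hs₁'
  rcases h3.eq_or_lt with h | h
  · rw [← h] at h7
    linarith
  · nlinarith

theorem false_of_isMax (hS : IsStewartSpace X) {E C : Set X} (hE : IsClosed E) (hH1 : H1Trivial E)
    (hC : ∀ x ∈ C, ∀ y ∈ C, ∀ m, Btw x m y → m ∈ C) (hCne : C.Nonempty)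
    {f : ℝ → X} {a t b R : ℝ} (hat : a < t) (htb : t < b)
    (hf : ∀ s ∈ Icc a b, ∀ s' ∈ Icc a b, dist (f s) (f s') ≤ |s - s'|)
    (hfE : ∀ s ∈ Icc a b, f s ∈ E) (hR : 0 < R) (hfin : HasFiniteFibers (ball (f t) R))
    (hfR : ∀ s ∈ Icc a b, dist (f s) (f t) ≤ R / 3)
    (hlt : ∀ s ∈ Ico a t, infDist (f s) C < infDist (f t) C)
    (hle : ∀ s ∈ Icc a b, infDist (f s) C ≤ infDist (f t) C)
    (hj : JoinedIn (E ∩ {y | infDist y C ≤ infDist (f t) C ∧ y ≠ f t}) (f b) (f a))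
    (hgeo : ∀ s ∈ Icc a b, ∀ s' ∈ Icc a b, ∀ m, (∀ n, Btw m n (f s) → n ∈ E) →
      (∀ n, Btw m n (f s') → n ∈ E) → |s - s'| ≤ dist m (f s) + dist m (f s')) : False := by
  have hfc : ContinuousOn f (Icc a b) := by
    have : LipschitzOnWith 1 f (Icc a b) := LipschitzOnWith.of_dist_le_mul fun s hs s' hs' => by
      simpa [Real.dist_eq] using hf s hs s' hs'
    exact this.continuousOn
  obtain ⟨w₁, hw₁, w₂, hw₂, m, hv, hm, hE₁, hE₂⟩ := hS.exists_bridge_of_isMax hE hH1 hC hCne hat htb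
    hfc hfE hR hfin hfR hlt hj
  set p := f t with hp
  set u := f w₁ with hu
  set v := f w₂ with hv'
  have hsub : Icc w₁ w₂ ⊆ Icc a b := Icc_subset_Icc hw₁.1 hw₂.2
  have hhu : infDist u C < infDist p C := hlt w₁ hw₁
  have hhv : infDist v C ≤ infDist p C := hle w₂ ⟨hat.le.trans hw₂.1, hw₂.2⟩
  have hpv : 0 < dist v p := dist_pos.2 hv
  -- a convex function strictly smaller on `[v, m] ∪ [m, u]` than at `p`
  obtain ⟨θ, hθ, hθu, hθm⟩ : ∃ θ > 0, infDist u C + θ * dist v u < infDist p C ∧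
      infDist m C + θ * dist v m < infDist p C := by
    have h : ∀ x, infDist x C < infDist p C → ∀ᶠ θ in nhdsWithin (0 : ℝ) (Ioi 0),
        infDist x C + θ * dist v x < infDist p C := by
      intro x hx
      have hc : Continuous fun θ : ℝ => infDist x C + θ * dist v x := by fun_prop
      exact (hc.tendsto 0).eventually_lt_const (by simpa using hx) |>.filter_mono nhdsWithin_le_nhds
    obtain ⟨θ, h1, h2, h3⟩ := ((h u hhu).and ((h m hm).and self_mem_nhdsWithin)).exists
    exact ⟨θ, h3, h1, h2⟩
  set φ : X → ℝ := fun z => infDist z C + θ * dist v z with hφ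
  have hφc : Continuous φ := by
    have := continuous_infDist_pt C
    fun_prop
  have hφp : infDist p C < φ p := by
    simp only [hφ]
    nlinarith [mul_pos hθ hpv]
  set A : Set X := {z | φ z ≤ infDist p C} with hA
  have hAc : IsClosed A := isClosed_le hφc continuous_const
  have hAconv : ∀ x ∈ A, ∀ y ∈ A, ∀ m, Btw x m y → m ∈ A := by
    intro x hx y hy n hn
    obtain ⟨τ, h3, h4, h5, h6⟩ := hn.exists_ratio
    have h7 := hS.infDist_le_of_ratio hC hCne h3 h4 h5 h6
    have h8 := hS.dist_le_of_ratio h3 h4 h5 h6 v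
    have hx' : (1 - τ) * φ x ≤ (1 - τ) * infDist p C :=
      mul_le_mul_of_nonneg_left hx (by linarith)
    have hy' : τ * φ y ≤ τ * infDist p C := mul_le_mul_of_nonneg_left hy h3
    change infDist n C + θ * dist v n ≤ _
    simp only [hφ] at hx' hy'
    nlinarith [mul_le_mul_of_nonneg_left h8 hθ.le]
  have huA : u ∈ A := hθu.le
  have hmA : m ∈ A := hθm.le
  have hvA : v ∈ A := by
    change infDist v C + θ * dist v v ≤ _
    simpa using hhv
  have hpA : 0 < infDist p A :=
    (hAc.notMem_iff_infDist_pos ⟨u, huA⟩).1 fun h => hφp.not_ge h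
  set M : ℝ := dist p u + dist p v + dist p m with hM
  have hM0 : 0 < M := by
    have : 0 < dist p v := by rwa [dist_comm]
    positivity
  obtain ⟨q, hqA, δ, hδ, hqδ⟩ := hS.exists_almost_projection hAconv ⟨u, huA⟩ hpA hM0
  have hpq : 0 < dist p q := hpA.trans_le (infDist_le_dist_of_mem hqA)
  obtain ⟨o, hpoq, hpo, hoε, hoq⟩ := hS.exists_btw_near hpq
    (show 0 < min (δ / 2) (R / 4) by positivity)
  have hoδ := hoε.trans (min_le_left _ _)
  have hoR := hoε.trans (min_le_right _ _)
  have hδq : 0 < δ / (2 * dist o q) := by positivity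
  have hball : ∀ x y, dist p x ≤ M → dist p y ≤ M → ∀ n, Btw x n y → dist p n ≤ M := by
    intro x y hx hy n hn
    obtain ⟨τ, h3, h4, h5, h6⟩ := hn.exists_ratio
    have h8 := hS.dist_le_of_ratio h3 h4 h5 h6 p
    nlinarith
  have hpu := dist_nonneg (x := p) (y := u)
  have hpv' := dist_nonneg (x := p) (y := v)
  have hpm := dist_nonneg (x := p) (y := m)
  have hseg : ∀ y ∈ A, dist p y ≤ M →
      dist y q ≤ dist y o - δ / (2 * dist o q) * dist o q := by
    intro y hy hyM
    have h1 : δ / (2 * dist o q) * dist o q = δ / 2 := by field_simp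
    have h2 := hqδ y hy hyM
    have h3 := dist_triangle p o y
    rw [dist_comm o y] at h3
    linarith
  have hj' : JoinedIn (E ∩ {y | dist y q ≤ dist y o - δ / (2 * dist o q) * dist o q}) v u := by
    refine JoinedIn.trans (y := m) (hS.joinedIn_of_btw fun n hn => ?_)
      (hS.joinedIn_of_btw fun n hn => ?_)
    · exact ⟨hE₂ n hn.symm, hseg n (hAconv v hvA m hmA n hn)
        (hball v m (by linarith) (by linarith) n hn)⟩
    · exact ⟨hE₁ n hn, hseg n (hAconv m hmA u huA n hn)
        (hball m u (by linarith) (by linarith) n hn)⟩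
  have hball' : closedBall o (2 * R / 3) ⊆ ball p R := by
    intro y hy
    rw [mem_closedBall] at hy
    rw [mem_ball]
    have h2 := dist_triangle y o p
    rw [dist_comm o p] at h2
    linarith
  have hfo : ∀ s ∈ Icc w₁ w₂, f s ∈ closedBall o (2 * R / 3) := by
    intro s hs
    rw [mem_closedBall]
    have h2 := dist_triangle (f s) p o
    have := hfR s (hsub hs)
    linarith
  obtain ⟨s₁, hs₁, s₂, hs₂, n, hz₁, hz₂, hn₁, hn₂, hF₁, hF₂⟩ :=
    hS.exists_bridge hE hH1 hw₁.2.le hw₂.1 (hfc.mono hsub) (fun s hs => hfE s (hsub hs)) hpoq hpo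
      hoq (c := δ / (2 * dist o q)) (ω := 0) (by linarith) (by norm_num) hδq
      hj' (hfin.mono hball') hfo
  have hs₁' := hsub ⟨hs₁.1, hs₁.2.trans hw₂.1⟩
  have hs₂' := hsub ⟨hw₁.2.le.trans hs₂.1, hs₂.2⟩
  have ht' : t ∈ Icc a b := ⟨hat.le, htb.le⟩
  have h1 := hgeo s₁ hs₁' s₂ hs₂' n hF₁ hF₂
  have h2 := hz₁.dist_lt hpo
  have h3 := hz₂.dist_lt hpo
  have h4 := hf t ht' s₁ hs₁'
  have h5 := hf t ht' s₂ hs₂'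
  rw [abs_of_nonneg (by linarith [hs₁.2])] at h4
  rw [abs_of_nonpos (by linarith [hs₂.1])] at h5
  rw [abs_of_nonpos (by linarith [hs₁.2, hs₂.1])] at h1
  have h6 := dist_nonneg (x := o) (y := n)
  unfold Btw at hn₁ hn₂
  linarith

end IsStewartSpace

theorem SCC.exists_isClosedEmbedding {X : Type*} [TopologicalSpace X] [T2Space X] (γ : SCC X) :
    ∃ Γ : AddCircle (1 : ℝ) → X, Topology.IsClosedEmbedding Γ ∧ range Γ = γ.img := by
  have hc := AddCircle.liftIco_zero_continuous γ.loop γ.contOn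
  have hval : ∀ x ∈ Ico (0 : ℝ) 1, AddCircle.liftIco 1 0 γ.toFun x = γ.toFun x := fun x hx =>
    AddCircle.liftIco_zero_coe_apply hx
  have hsurj : ∀ c : AddCircle (1 : ℝ), ∃ x ∈ Ico (0 : ℝ) 1, (x : AddCircle (1 : ℝ)) = c := by
    intro c
    have := AddCircle.coe_image_Ico_eq (1 : ℝ) 0 ▸ mem_univ c
    rwa [zero_add] at this
  refine ⟨_, hc.isClosedEmbedding ?_, ?_⟩
  · intro c c' h
    obtain ⟨x, hx, rfl⟩ := hsurj c
    obtain ⟨x', hx', rfl⟩ := hsurj c'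
    rw [hval x hx, hval x' hx'] at h
    rw [γ.inj hx hx' h]
  · refine Subset.antisymm ?_ ?_
    · rintro _ ⟨c, rfl⟩
      obtain ⟨x, hx, rfl⟩ := hsurj c
      exact ⟨x, Ico_subset_Icc_self hx, (hval x hx).symm⟩
    · rintro _ ⟨x, hx, rfl⟩
      rcases hx.2.eq_or_lt with rfl | h
      · exact ⟨(0 : ℝ), by rw [hval 0 (by simp), γ.loop]⟩
      · exact ⟨x, hval x ⟨hx.1, h⟩⟩

theorem SCC.joinedIn_diff_singleton {X : Type*} [TopologicalSpace X] [T2Space X] (γ : SCC X)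
    {p x y : X} (hp : p ∈ γ.img) (hx : x ∈ γ.img \ {p}) (hy : y ∈ γ.img \ {p}) :
    JoinedIn (γ.img \ {p}) x y := by
  obtain ⟨Γ, hΓ, hr⟩ := γ.exists_isClosedEmbedding
  obtain ⟨c, rfl⟩ := hr ▸ hp
  induction c using QuotientAddGroup.induction_on with | H a => ?_
  have hpc : IsPathConnected ({(a : AddCircle (1 : ℝ))}ᶜ) := by
    have h := (AddCircle.openPartialHomeomorphCoe (1 : ℝ) a).image_source_eq_target
    rw [AddCircle.openPartialHomeomorphCoe_target] at h
    rw [← h]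
    refine IsPathConnected.image' ?_ (OpenPartialHomeomorph.continuousOn _)
    exact (convex_Ioo a (a + 1)).isPathConnected ⟨a + 1 / 2, by constructor <;> linarith⟩
  have himg : Γ '' ({(a : AddCircle (1 : ℝ))}ᶜ) = γ.img \ {Γ (a : AddCircle (1 : ℝ))} := by
    rw [image_compl_eq_range_sdiff_image hΓ.injective, image_singleton, hr]
  have := hpc.image hΓ.continuous
  rw [himg] at this
  exact this.joinedIn x hx y hy

theorem SCC.exists_nhds_inter_subset_image {X : Type*} [TopologicalSpace X] [T2Space X]
    (γ : SCC X) {f : ℝ → X} {a b t : ℝ} (ht : t ∈ Ioo a b) (hf : ContinuousOn f (Icc a b))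
    (hinj : InjOn f (Icc a b)) (hγ : f '' Icc a b ⊆ γ.img) :
    ∃ U ∈ nhds (f t), γ.img ∩ U ⊆ f '' Icc a b := by
  obtain ⟨Γ, hΓ, hr⟩ := γ.exists_isClosedEmbedding
  set g : ℝ → AddCircle (1 : ℝ) := fun s => Function.invFun Γ (f s) with hg
  have hΓg : ∀ s ∈ Icc a b, Γ (g s) = f s := fun s hs =>
    Function.invFun_eq (hr.symm ▸ hγ ⟨s, hs, rfl⟩ : f s ∈ range Γ)
  have hgc : ContinuousOn g (Icc a b) := by
    rw [hΓ.isInducing.continuousOn_iff]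
    exact hf.congr hΓg
  have htI : t ∈ Icc a b := Ioo_subset_Icc_self ht
  obtain ⟨x, hx⟩ := QuotientAddGroup.mk_surjective (g t)
  set e := AddCircle.openPartialHomeomorphCoe (1 : ℝ) (x - 1 / 2) with he
  have hxs : x ∈ e.source := by
    change x ∈ Ioo _ _
    constructor <;> linarith
  have hex : e x = g t := hx
  have hgt : g t ∈ e.target := hex ▸ e.map_source hxs
  have hnhds : g ⁻¹' e.target ∩ Icc a b ∈ nhds t :=
    inter_mem ((hgc.continuousAt (Icc_mem_nhds ht.1 ht.2)).preimage_mem_nhds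
      (e.open_target.mem_nhds hgt)) (Icc_mem_nhds ht.1 ht.2)
  obtain ⟨ε, hε, hsub⟩ := Metric.nhds_basis_closedBall.mem_iff.1 hnhds
  rw [Real.closedBall_eq_Icc] at hsub
  have hsub2 : Icc (t - ε) (t + ε) ⊆ Icc a b := hsub.trans inter_subset_right
  set k : ℝ → ℝ := fun s => e.symm (g s) with hk
  have hek : ∀ s ∈ Icc (t - ε) (t + ε), e (k s) = g s := fun s hs => e.right_inv (hsub hs).1
  have hkc : ContinuousOn k (Icc (t - ε) (t + ε)) :=
    e.continuousOn_symm.comp (hgc.mono hsub2) fun s hs => (hsub hs).1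
  have hki : InjOn k (Icc (t - ε) (t + ε)) := by
    intro s hs s' hs' h
    refine hinj (hsub2 hs) (hsub2 hs') ?_
    rw [← hΓg s (hsub2 hs), ← hΓg s' (hsub2 hs'), ← hek s hs, ← hek s' hs', h]
  have hkt : k t = x := by
    rw [hk, ← e.left_inv hxs, hex]
  have m0 : t - ε ∈ Icc (t - ε) (t + ε) := ⟨le_rfl, by linarith⟩
  have m1 : t ∈ Icc (t - ε) (t + ε) := ⟨by linarith, by linarith⟩
  have m2 : t + ε ∈ Icc (t - ε) (t + ε) := ⟨by linarith, le_rfl⟩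
  obtain ⟨V, hV, hxV, hVk⟩ : ∃ V : Set ℝ, IsOpen V ∧ x ∈ V ∧ V ⊆ k '' Icc (t - ε) (t + ε) := by
    rcases hkc.strictMonoOn_of_injOn_Icc' (by linarith) hki with h | h
    · refine ⟨Ioo (k (t - ε)) (k (t + ε)), isOpen_Ioo, ?_,
        Ioo_subset_Icc_self.trans (intermediate_value_Icc (by linarith) hkc)⟩
      rw [← hkt]
      exact ⟨h m0 m1 (by linarith), h m1 m2 (by linarith)⟩
    · refine ⟨Ioo (k (t + ε)) (k (t - ε)), isOpen_Ioo, ?_,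
        Ioo_subset_Icc_self.trans (intermediate_value_Icc' (by linarith) hkc)⟩
      rw [← hkt]
      exact ⟨h m1 m2 (by linarith), h m0 m1 (by linarith)⟩
  have hopen : IsOpen (e '' (V ∩ e.source)) :=
    e.isOpen_image_of_subset_source (hV.inter e.open_source) inter_subset_right
  obtain ⟨U, hU, hUe⟩ := hΓ.isInducing.isOpen_iff.1 hopen
  refine ⟨U, hU.mem_nhds ?_, ?_⟩
  · rw [← hΓg t htI, ← mem_preimage, hUe, ← hex]
    exact ⟨x, ⟨hxV, hxs⟩, rfl⟩
  · rintro y ⟨hy, hyU⟩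
    rw [← hr] at hy
    obtain ⟨c, rfl⟩ := hy
    rw [← mem_preimage, hUe] at hyU
    obtain ⟨v, ⟨hv, -⟩, rfl⟩ := hyU
    obtain ⟨s, hs, rfl⟩ := hVk hv
    exact ⟨s, hsub2 hs, by rw [hek s hs, hΓg s (hsub2 hs)]⟩

theorem RectConnected.dist_le_pathDistIn {X : Type*} [MetricSpace X] {E : Set X}
    (hE : RectConnected E) {x y : X} (hx : x ∈ E) (hy : y ∈ E) : dist x y ≤ pathDistIn E x y := by
  obtain ⟨g, hg, hgv⟩ := hE x hx y hy
  rw [dist_edist, pathDistIn]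
  refine ENNReal.toReal_mono (ne_top_of_le_ne_top hgv (iInf_le (fun g : {g // IsPathIn E g x y} =>
    eVariationOn g.1 (Icc 0 1)) ⟨g, hg⟩)) (le_iInf fun ⟨g, hg⟩ => ?_)
  have := eVariationOn.edist_le g (s := Icc (0 : ℝ) 1) (x := 0) (y := 1) (by simp) (by simp)
  rwa [hg.2.1, hg.2.2.1] at this

theorem IsStewartSpace.pathDistIn_le {X : Type*} [MetricSpace X] (hS : IsStewartSpace X)
    {E : Set X} {u v m : X} (hu : ∀ n, Btw m n u → n ∈ E) (hv : ∀ n, Btw m n v → n ∈ E) :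
    pathDistIn E u v ≤ dist m u + dist m v := by
  rw [dist_comm m u]
  set L : ℝ := dist u m + dist m v with hL
  have hL0 : 0 ≤ L := by positivity
  set G : ℝ → X := fun r => if r ≤ dist u m then hS.pt u m r else hS.pt m v (r - dist u m) with hG
  have hGle : ∀ r ∈ Icc 0 L, ∀ r' ∈ Icc 0 L, r ≤ r' → dist (G r) (G r') ≤ r' - r := by
    intro r hr r' hr' hrr
    simp only [hG]
    split_ifs with h1 h2 h2
    · exact hS.dist_pt_pt_le hr.1 hrr
    · have h3 := hS.dist_pt_right hr.1 h1
      have h4 : dist m (hS.pt m v (r' - dist u m)) = r' - dist u m :=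
        hS.dist_pt (by linarith) (by linarith [hr'.2])
      have h5 := dist_triangle (hS.pt u m r) m (hS.pt m v (r' - dist u m))
      linarith
    · exact absurd (hrr.trans h2) h1
    · have := hS.dist_pt_pt_le (o := m) (z := v) (r := r - dist u m) (r' := r' - dist u m)
        (by linarith) (by linarith)
      linarith
  have hmaps : MapsTo (fun τ : ℝ => L * τ) (Icc 0 1) (Icc 0 L) := fun τ hτ =>
    ⟨mul_nonneg hL0 hτ.1, mul_le_of_le_one_right hL0 hτ.2⟩
  have hLip : LipschitzOnWith 1 G (Icc 0 L) := LipschitzOnWith.of_dist_le_mul fun r hr r' hr' => by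
    rw [NNReal.coe_one, one_mul, Real.dist_eq]
    rcases le_total r r' with h | h
    · rw [abs_sub_comm]
      exact (hGle r hr r' hr' h).trans (le_abs_self _)
    · rw [dist_comm]
      exact (hGle r' hr' r hr h).trans (le_abs_self _)
  have hpath : IsPathIn E (G ∘ fun τ : ℝ => L * τ) u v := by
    refine ⟨hLip.continuousOn.comp (by fun_prop) hmaps, ?_, ?_, fun τ hτ => ?_⟩
    · simp [hG, hS.pt_zero]
    · simp only [hG, Function.comp, mul_one]
      split_ifs with h
      · have h0 : dist m v = 0 := le_antisymm (by linarith) dist_nonneg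
        rw [hS.pt_of_dist_le (by rw [hL]; linarith), dist_eq_zero.1 h0]
      · exact hS.pt_of_dist_le (by rw [hL]; linarith)
    · simp only [hG, Function.comp]
      split_ifs with h
      · exact hu _ (hS.btw_pt _ _ _).symm
      · exact hv _ (hS.btw_pt _ _ _)
  have hvar : eVariationOn (G ∘ fun τ : ℝ => L * τ) (Icc 0 1) ≤ ENNReal.ofReal L := by
    refine (hLip.comp_eVariationOn_le hmaps).trans ?_
    rw [ENNReal.coe_one, one_mul]
    have hmono : MonotoneOn (fun τ : ℝ => L * τ) (Icc 0 1) := fun τ _ τ' _ h =>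
      mul_le_mul_of_nonneg_left h hL0
    have := (hmono.eVariationOn_eq (a := 0) (b := 1) (by simp) (by simp)).le
    simpa using this
  rw [pathDistIn]
  exact ENNReal.toReal_le_of_le_ofReal hL0 ((iInf_le _ ⟨_, hpath⟩).trans hvar)

theorem false_of_lt_of_lt {κ : ℝ} (hκ : κ ≤ 0) {X : Type*} [MetricSpace X]
    (PC : PolyComplex2 κ X) (hS : IsStewartSpace X)
    {E : Set X} (hE : IsClosed E) (hErc : RectConnected E) (hH1 : H1Trivial E)
    {γ : SCC X} (hγE : γ.img ⊆ E)
    {C : Set X} (hC : ∀ x ∈ C, ∀ y ∈ C, ∀ m, Btw x m y → m ∈ C) (hCne : C.Nonempty)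
    {f : ℝ → X} {a b t : ℝ} (ht : t ∈ Ioo a b)
    (hf : ∀ s ∈ Icc a b, ∀ s' ∈ Icc a b, pathDistIn E (f s) (f s') = |s - s'|)
    (hfγ : f '' Icc a b ⊆ γ.img) (hmax : ∀ y ∈ γ.img, infDist y C ≤ infDist (f t) C)
    {s₀ : ℝ} (hs₀ : s₀ ∈ Icc a b) (hs₀t : s₀ < t) (hlt : infDist (f s₀) C < infDist (f t) C) :
    False := by
  have hfγ' : ∀ s ∈ Icc a b, f s ∈ γ.img := fun s hs => hfγ ⟨s, hs, rfl⟩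
  have hfE : ∀ s ∈ Icc a b, f s ∈ E := fun s hs => hγE (hfγ' s hs)
  have hfL : ∀ s ∈ Icc a b, ∀ s' ∈ Icc a b, dist (f s) (f s') ≤ |s - s'| := fun s hs s' hs' =>
    (hErc.dist_le_pathDistIn (hfE s hs) (hfE s' hs')).trans_eq (hf s hs s' hs')
  have hfc : ContinuousOn f (Icc a b) := by
    have : LipschitzOnWith 1 f (Icc a b) := LipschitzOnWith.of_dist_le_mul fun s hs s' hs' => by
      simpa [Real.dist_eq] using hfL s hs s' hs'
    exact this.continuousOn
  have hinj : InjOn f (Icc a b) := by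
    intro s hs s' hs' h
    have h1 := hf s hs s hs
    have h2 := hf s hs s' hs'
    rw [← h, h1, sub_self, abs_zero] at h2
    exact sub_eq_zero.1 (abs_eq_zero.1 h2.symm)
  have hsub : Icc s₀ t ⊆ Icc a b := Icc_subset_Icc hs₀.1 ht.2.le
  have hcpt : IsCompact {s ∈ Icc s₀ t | infDist (f t) C ≤ infDist (f s) C} := by
    refine isCompact_Icc.of_isClosed_subset ?_ (sep_subset _ _)
    exact ((continuous_infDist_pt C).comp_continuousOn (hfc.mono hsub)).preimage_isClosed_of_isClosed
      isClosed_Icc isClosed_Ici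
  obtain ⟨t₀, ⟨ht₀, ht₀D⟩, hmin⟩ := hcpt.exists_isLeast ⟨t, ⟨hs₀t.le, le_rfl⟩, le_rfl⟩
  have hD : infDist (f t₀) C = infDist (f t) C := le_antisymm (hmax _ (hfγ' _ (hsub ht₀))) ht₀D
  have hst : s₀ < t₀ := by
    refine lt_of_le_of_ne ht₀.1 ?_
    rintro rfl
    exact hlt.ne hD
  have htb : t₀ < b := ht₀.2.trans_lt ht.2
  obtain ⟨R, hR, hfin⟩ := PolyComplex2.exists_hasFiniteFibers hκ PC (f t₀)
  set a₂ := max s₀ (t₀ - R / 3) with ha₂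
  set b₂ := min b (t₀ + R / 3) with hb₂
  have ha : a₂ < t₀ := max_lt hst (by linarith)
  have hb : t₀ < b₂ := lt_min htb (by linarith)
  have hsub₂ : Icc a₂ b₂ ⊆ Icc a b :=
    Icc_subset_Icc (hs₀.1.trans (le_max_left _ _)) (min_le_left _ _)
  have ht₀I : t₀ ∈ Icc a b := hsub ht₀
  have haI : a₂ ∈ Icc a b := hsub₂ ⟨le_rfl, (ha.trans hb).le⟩
  have hbI : b₂ ∈ Icc a b := hsub₂ ⟨(ha.trans hb).le, le_rfl⟩
  refine hS.false_of_isMax hE hH1 hC hCne ha hb (fun s hs s' hs' => hfL s (hsub₂ hs) s' (hsub₂ hs'))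
    (fun s hs => hfE s (hsub₂ hs)) hR hfin (fun s hs => ?_) (fun s hs => ?_)
    (fun s hs => hD ▸ hmax _ (hfγ' s (hsub₂ hs))) ?_ (fun s hs s' hs' m hm hm' => ?_)
  · refine (hfL s (hsub₂ hs) t₀ ht₀I).trans (abs_le.2 ⟨?_, ?_⟩)
    · linarith [hs.1, le_max_right s₀ (t₀ - R / 3)]
    · linarith [hs.2, min_le_right b (t₀ + R / 3)]
  · by_contra! h
    exact hs.2.not_ge (hmin ⟨⟨(le_max_left _ _).trans hs.1, hs.2.le.trans ht₀.2⟩, hD ▸ h⟩)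
  · refine (γ.joinedIn_diff_singleton (hfγ' t₀ ht₀I) ⟨hfγ' b₂ hbI, fun h => ?_⟩
      ⟨hfγ' a₂ haI, fun h => ?_⟩).mono fun y hy => ⟨hγE hy.1, hD ▸ hmax y hy.1, hy.2⟩
    · exact hb.ne' (hinj hbI ht₀I h)
    · exact ha.ne (hinj haI ht₀I h)
  · rw [← hf s (hsub₂ hs) s' (hsub₂ hs')]
    exact hS.pathDistIn_le hm hm'

end Cat2Cx

open Cat2Cx in
/-- **Lemma (principal_lemma).**  Let `C` be a closed convex subset of `X` and `γ` a simple
closed curve in `E`.  Let `p` be a point of `γ` where `dist_C` attains its maximum over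
`γ` but is not locally constant on `γ`.  Then `γ` is not locally geodesic in `Y` at `p`. -/
theorem not_locally_Y_geodesic_at_distance_maximum
    {κ : ℝ} (hκ : κ ≤ 0) {X : Type*} [MetricSpace X]
    (PC : PolyComplex2 κ X) (hX : IsCATSpace κ X)
    (E : Set X) (hEclosed : IsClosed E) (hErc : RectConnected E) (hH1 : H1Trivial ↥E)
    (γ : SCC X) (hγE : γ.img ⊆ E)
    (C : Set X) (hCcl : IsClosed C) (hCconv : ConvexWrt (xDist X) C)
    (p : X) (hp : p ∈ γ.img)
    (hmax : ∀ y ∈ γ.img, Metric.infDist y C ≤ Metric.infDist p C)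
    (hnotconst : ¬ ∃ U ∈ nhds p, ∀ y ∈ γ.img ∩ U, Metric.infDist y C = Metric.infDist p C) :
    ¬ LocallyYGeodesicAt E γ.img p := by
  rintro ⟨f, a, b, t, ht, rfl, ⟨-, hf⟩, hfE, hfγ⟩
  have hS := hX.isStewartSpace hκ
  have hC : ∀ x ∈ C, ∀ y ∈ C, ∀ m, Btw x m y → m ∈ C := fun x hx y hy m hm =>
    hX.mem_of_btw hκ hCconv hx hy hm
  have hCne : C.Nonempty := by
    rw [Set.nonempty_iff_ne_empty]
    rintro rfl
    exact hnotconst ⟨Set.univ, univ_mem, by simp⟩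
  obtain ⟨s₀, hs₀, hlt⟩ : ∃ s ∈ Icc a b, infDist (f s) C < infDist (f t) C := by
    by_contra! h
    have hfc : ContinuousOn f (Icc a b) := by
      have : LipschitzOnWith 1 f (Icc a b) := LipschitzOnWith.of_dist_le_mul fun s hs s' hs' => by
        have := hErc.dist_le_pathDistIn (hfE hs) (hfE hs')
        rw [hf s hs s' hs'] at this
        simpa [Real.dist_eq] using this
      exact this.continuousOn
    have hinj : InjOn f (Icc a b) := by
      intro s hs s' hs' h
      have h1 := hf s hs s hs
      have h2 := hf s hs s' hs'
      rw [← h, h1, sub_self, abs_zero] at h2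
      exact sub_eq_zero.1 (abs_eq_zero.1 h2.symm)
    obtain ⟨U, hU, hUf⟩ := γ.exists_nhds_inter_subset_image ht hfc hinj hfγ
    refine hnotconst ⟨U, hU, fun y hy => le_antisymm (hmax y hy.1) ?_⟩
    obtain ⟨s, hs, rfl⟩ := hUf hy
    exact h s hs
  have hne : s₀ ≠ t := by
    rintro rfl
    exact lt_irrefl _ hlt
  rcases hne.lt_or_gt with h | h
  · exact false_of_lt_of_lt hκ PC hS hEclosed hErc hH1 hγE hC hCne ht hf hfγ hmax hs₀ h hlt
  · have hneg : ∀ s : ℝ, s ∈ Icc (-b) (-a) → -s ∈ Icc a b := fun s hs =>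
      ⟨by linarith [hs.2], by linarith [hs.1]⟩
    refine false_of_lt_of_lt hκ PC hS hEclosed hErc hH1 hγE hC hCne (f := fun s => f (-s))
      (a := -b) (b := -a) (t := -t) (s₀ := -s₀) ⟨by linarith [ht.2], by linarith [ht.1]⟩
      (fun s hs s' hs' => ?_) ?_ (by simpa using hmax) ⟨by linarith [hs₀.2], by linarith [hs₀.1]⟩
      (by linarith) (by simpa using hlt)
    · rw [hf _ (hneg s hs) _ (hneg s' hs'), neg_sub_neg, abs_sub_comm]
    · rintro _ ⟨s, hs, rfl⟩
      exact hfγ ⟨-s, hneg s hs, rfl⟩
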